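/- arXiv:1406.6517 — 5 statements merged into one kernel-verified Lean document; each statement's English description precedes it below -/
import Mathlib

section
/- Let G be a homogeneous m-generic L-graph and let A ∈ O(G). Then for every pair of distinct parts V_i, V_j in which A has vertices, the bipartite restriction of A to V_i and V_j is monochromatic: all edges of A between its vertices in V_i and its vertices in V_j have the same colour. -/
/-!
Common framework: coloured multipartite graphs in a finite language `L`.
Colours are natural numbers; for each pair of distinct parts `i j : Fin m`
there is a finite nonempty colour set `C i j`.
-/

/-- A finite language for coloured `m`-partite graphs. -/
structure MLang (m : ℕ) where
  C : Fin m → Fin m → Finset ℕ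
  symm : ∀ i j, C i j = C j i
  nonempty : ∀ i j, i ≠ j → (C i j).Nonempty

/-- A coloured `m`-partite `L`-graph: vertices partitioned into parts `V_0, …, V_{m-1}`,
with a symmetric colouring of cross-part pairs taking values in the colour sets of `L`.
(The value of `colour` on pairs within a part is irrelevant junk data.) -/
structure LGraph {m : ℕ} (L : MLang m) where
  V : Type
  part : V → Fin m
  colour : V → V → ℕ
  colour_symm : ∀ x y, colour x y = colour y x
  colour_mem : ∀ x y, part x ≠ part y → colour x y ∈ L.C (part x) (part y)

namespace LGraph

variable {m : ℕ} {L : MLang m}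

/-- The induced subgraph of `A` on a set `S` of its vertices. -/
def restrict (A : LGraph L) (S : Set A.V) : LGraph L where
  V := S
  part x := A.part x.1
  colour x y := A.colour x.1 y.1
  colour_symm := fun x y => A.colour_symm x.1 y.1
  colour_mem := fun x y h => A.colour_mem x.1 y.1 h

/-- `f` is an embedding of `A` into `G`: injective, part-preserving, colour-preserving. -/
def IsEmbedding (A G : LGraph L) (f : A.V → G.V) : Prop :=
  Function.Injective f ∧ (∀ x, G.part (f x) = A.part x) ∧
    ∀ x y : A.V, A.part x ≠ A.part y → G.colour (f x) (f y) = A.colour x y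

/-- `A` is realized in `G`, i.e. `A` embeds into `G`. -/
def Realized (G A : LGraph L) : Prop := ∃ f : A.V → G.V, IsEmbedding A G f

/-- `A` and `B` are isomorphic `L`-graphs. -/
def IsIsomorphic (A B : LGraph L) : Prop :=
  ∃ f : A.V → B.V, IsEmbedding A B f ∧ Function.Surjective f

/-- `φ` restricted to `S` is an isomorphism between induced subgraphs of `G`
(a partial automorphism of `G`). -/
def IsPartialIso (G : LGraph L) (S : Set G.V) (φ : G.V → G.V) : Prop :=
  Set.InjOn φ S ∧ (∀ x ∈ S, G.part (φ x) = G.part x) ∧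
    ∀ x ∈ S, ∀ y ∈ S, G.part x ≠ G.part y → G.colour (φ x) (φ y) = G.colour x y

/-- `G` is homogeneous: every isomorphism between finite induced subgraphs of `G`
extends to an automorphism of `G`. -/
def Homogeneous (G : LGraph L) : Prop :=
  ∀ S : Set G.V, S.Finite → ∀ φ : G.V → G.V, G.IsPartialIso S φ →
    ∃ ψ : G.V ≃ G.V, (∀ x, G.part (ψ x) = G.part x) ∧
      (∀ x y : G.V, G.part x ≠ G.part y → G.colour (ψ x) (ψ y) = G.colour x y) ∧
      ∀ x ∈ S, ψ x = φ x

/-- `G` is `m`-generic: every part is countably infinite and every bipartite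
restriction is generic. -/
def Generic (G : LGraph L) : Prop :=
  Countable G.V ∧ (∀ i : Fin m, {x : G.V | G.part x = i}.Infinite) ∧
    ∀ i j : Fin m, i ≠ j → ∀ U : Finset G.V, (∀ u ∈ U, G.part u = i) →
      ∀ f : G.V → ℕ, (∀ u ∈ U, f u ∈ L.C i j) →
        ∃ x : G.V, G.part x = j ∧ ∀ u ∈ U, G.colour x u = f u

/-- `A` is minimally omitted from `G` (membership in `O(G)`): `A` is finite and omitted,
but every proper induced subgraph of `A` is realized in `G`. -/
def MinOmitted (G A : LGraph L) : Prop :=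
  Finite A.V ∧ ¬ G.Realized A ∧ ∀ S : Set A.V, S ≠ Set.univ → G.Realized (A.restrict S)

/-- `A` is monic: at most one vertex in each part. -/
def Monic (A : LGraph L) : Prop := ∀ x y : A.V, A.part x = A.part y → x = y

/-- `A` covers colour `c` on the restriction `V_i V_j`: it has vertices in `V_i` and `V_j`
joined by a `c`-coloured edge. -/
def Covers (A : LGraph L) (i j : Fin m) (c : ℕ) : Prop :=
  ∃ x y : A.V, A.part x = i ∧ A.part y = j ∧ A.colour x y = c

/-- `A` is an `ijk`-triangle: a monic with vertices in exactly the parts `V_i, V_j, V_k`. -/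
def IsTriangleOn (A : LGraph L) (i j k : Fin m) : Prop :=
  A.Monic ∧ (∀ x : A.V, A.part x = i ∨ A.part x = j ∨ A.part x = k) ∧
    (∃ x : A.V, A.part x = i) ∧ (∃ x : A.V, A.part x = j) ∧ (∃ x : A.V, A.part x = k)

/-- `A` is a triangle: an `ijk`-triangle for some pairwise distinct `i, j, k`. -/
def IsTriangle (A : LGraph L) : Prop :=
  ∃ i j k : Fin m, i ≠ j ∧ i ≠ k ∧ j ≠ k ∧ A.IsTriangleOn i j k

end LGraph

open LGraph

variable {m : ℕ} {L : MLang m}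

/-- A `C_{ij}`-cover set: a set of monics covering every colour of `C i j` on `V_i V_j`. -/
def IsCoverSet (𝒜 : Set (LGraph L)) (i j : Fin m) : Prop :=
  (∀ A ∈ 𝒜, A.Monic) ∧ ∀ c ∈ L.C i j, ∃ A ∈ 𝒜, A.Covers i j c

/-- A `C_{ij}^{kl}`-omission set with code `(i,j,k,l; cik, cil, cjk, cjl)`:
a `C_{ij}`-cover set of `ijk`-triangles and `ijl`-triangles all of whose
`E_{ik}, E_{il}, E_{jk}, E_{jl}`-edges have the indicated colours. -/
def IsOmissionSet (S : Set (LGraph L)) (i j k l : Fin m) (cik cil cjk cjl : ℕ) : Prop :=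
  IsCoverSet S i j ∧
  (∀ A ∈ S, A.IsTriangleOn i j k ∨ A.IsTriangleOn i j l) ∧
  (∀ A ∈ S, ∀ x y : A.V, A.part x = i → A.part y = k → A.colour x y = cik) ∧
  (∀ A ∈ S, ∀ x y : A.V, A.part x = i → A.part y = l → A.colour x y = cil) ∧
  (∀ A ∈ S, ∀ x y : A.V, A.part x = j → A.part y = k → A.colour x y = cjk) ∧
  (∀ A ∈ S, ∀ x y : A.V, A.part x = j → A.part y = l → A.colour x y = cjl)

/-- The code `(i,j,k,l; cik, cil, cjk, cjl)` is based on the cover set `𝒜`. -/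
def BasedOn (𝒜 : Set (LGraph L)) (i j k l : Fin m) (cik cil cjk cjl : ℕ) : Prop :=
  ∃ A ∈ 𝒜, ∃ A' ∈ 𝒜,
    A.Covers i k cik ∧ A.Covers j k cjk ∧ A'.Covers i l cil ∧ A'.Covers j l cjl

/-- The code `(i,j,k,l; cik, cil, cjk, cjl)` is based on triangles from the cover set `𝒜`. -/
def BasedOnTriangles (𝒜 : Set (LGraph L)) (i j k l : Fin m) (cik cil cjk cjl : ℕ) : Prop :=
  ∃ A ∈ 𝒜, ∃ A' ∈ 𝒜, A.IsTriangle ∧ A'.IsTriangle ∧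
    A.Covers i k cik ∧ A.Covers j k cjk ∧ A'.Covers i l cil ∧ A'.Covers j l cjl

/-- The age of `G`: the class of finite `L`-graphs embedding into `G`. -/
def Age (G : LGraph L) : Set (LGraph L) := {A | Finite A.V ∧ G.Realized A}

/-- `Forb F`: the class of finite `L`-graphs into which no member of `F` embeds. -/
def Forb (F : Set (LGraph L)) : Set (LGraph L) :=
  {B | Finite B.V ∧ ∀ A ∈ F, ¬ B.Realized A}

/-- An amalgamation class: a class of finite `L`-graphs closed under isomorphism and
induced subgraphs with the amalgamation property. -/
def IsAmalgamationClass (𝒞 : Set (LGraph L)) : Prop :=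
  (∀ A ∈ 𝒞, Finite A.V) ∧
  (∀ A ∈ 𝒞, ∀ B : LGraph L, A.IsIsomorphic B → B ∈ 𝒞) ∧
  (∀ A ∈ 𝒞, ∀ S : Set A.V, A.restrict S ∈ 𝒞) ∧
  ∀ A B₁ B₂ : LGraph L, A ∈ 𝒞 → B₁ ∈ 𝒞 → B₂ ∈ 𝒞 →
    ∀ (f₁ : A.V → B₁.V) (f₂ : A.V → B₂.V),
      IsEmbedding A B₁ f₁ → IsEmbedding A B₂ f₂ →
      ∃ C ∈ 𝒞, ∃ (g₁ : B₁.V → C.V) (g₂ : B₂.V → C.V),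
        IsEmbedding B₁ C g₁ ∧ IsEmbedding B₂ C g₂ ∧ g₁ ∘ f₁ = g₂ ∘ f₂

section Parts01

variable [NeZero m]

/-- `A ≤₀₁ B`: `A` is an off-`E_{01}`-subgraph of `B`, i.e. `A` embeds into `B` ignoring
the colours of edges between `V_0` and `V_1` (equivalently, `A` embeds into the graph
obtained from `B` by recolouring its `E_{01}`-edge with the `E_{01}`-colour of `A`). -/
def Le01 (A B : LGraph L) : Prop :=
  ∃ f : A.V → B.V, Function.Injective f ∧ (∀ x, B.part (f x) = A.part x) ∧
    ∀ x y : A.V, A.part x ≠ A.part y →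
      ¬((A.part x = 0 ∧ A.part y = 1) ∨ (A.part x = 1 ∧ A.part y = 0)) →
      B.colour (f x) (f y) = A.colour x y

/-- `A` and `B` are off-`E_{01}`-isomorphic. -/
def OffIso01 (A B : LGraph L) : Prop := Le01 A B ∧ Le01 B A

/-- `A` is a maximal element of the quasi-order `(𝒜, ≤₀₁)`. -/
def MaxIn (𝒜 : Set (LGraph L)) (A : LGraph L) : Prop :=
  A ∈ 𝒜 ∧ ∀ B ∈ 𝒜, Le01 A B → Le01 B A

/-- `𝒜 ∈ Λ`: a `C_{01}`-cover set contained in `O(G)` of size exactly `|C_{01}|`. -/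
def InLambda (G : LGraph L) (𝒜 : Set (LGraph L)) : Prop :=
  (∀ A ∈ 𝒜, G.MinOmitted A) ∧ IsCoverSet 𝒜 0 1 ∧ 𝒜.ncard = (L.C 0 1).card

/-- The graph obtained from `A` by recolouring its `E_{01}`-edge with `α`
(that is, `A^{c/α}` where `c` is the `E_{01}`-colour of `A`) is realized in `G`. -/
def RealizedRecoloured01 (G A : LGraph L) (α : ℕ) : Prop :=
  ∃ f : A.V → G.V, Function.Injective f ∧ (∀ x, G.part (f x) = A.part x) ∧
    (∀ x y : A.V, A.part x ≠ A.part y →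
      ¬((A.part x = 0 ∧ A.part y = 1) ∨ (A.part x = 1 ∧ A.part y = 0)) →
      G.colour (f x) (f y) = A.colour x y) ∧
    ∀ x y : A.V, A.part x = 0 → A.part y = 1 → G.colour (f x) (f y) = α

/-- `Ω₀₁(𝒜) ⊆ Ω₀₁(ℬ)`: every code `(0,1,k,l; c_{0k}, c_{0l}, c_{1k}, c_{1l})`
based on `𝒜` is based on `ℬ`. -/
def Omega01Le (𝒜 ℬ : Set (LGraph L)) : Prop :=
  ∀ k l : Fin m, k ≠ l → k ≠ 0 → k ≠ 1 → l ≠ 0 → l ≠ 1 →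
    ∀ c0k c0l c1k c1l : ℕ,
      BasedOn 𝒜 0 1 k l c0k c0l c1k c1l → BasedOn ℬ 0 1 k l c0k c0l c1k c1l

/-- `ℬ` is a good `C_{01}`-cover set (for `G`): there is a key colour `α ∈ C_{01}` with key
monic `A^α ∈ ℬ` such that every member of `ℬ`, after recolouring its `E_{01}`-edge by `α`,
is either an (off-`E_{01}`-)subgraph of `A^α` or realized in `G`. -/
def GoodCoverSet (G : LGraph L) (ℬ : Set (LGraph L)) : Prop :=
  ∃ α ∈ L.C 0 1, ∃ Aα ∈ ℬ, Aα.Covers 0 1 α ∧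
    ∀ A ∈ ℬ, Le01 A Aα ∨ RealizedRecoloured01 G A α

/-- `ℬ` is a star `C_{01}`-cover set: good, with a key monic which either has vertices
in at least four parts, or has vertices in exactly three parts `V_0, V_1, V_i` while no
other member of `ℬ` has vertices in all of the remaining parts. -/
def StarCoverSet (G : LGraph L) (ℬ : Set (LGraph L)) : Prop :=
  ∃ α ∈ L.C 0 1, ∃ Aα ∈ ℬ, Aα.Covers 0 1 α ∧
    (∀ A ∈ ℬ, Le01 A Aα ∨ RealizedRecoloured01 G A α) ∧
    (4 ≤ (Set.range Aα.part).ncard ∨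
      ∃ i : Fin m, i ≠ 0 ∧ i ≠ 1 ∧ Set.range Aα.part = {0, 1, i} ∧
        ∀ B ∈ ℬ, B ≠ Aα → ∃ p : Fin m, p ≠ 0 ∧ p ≠ 1 ∧ p ≠ i ∧ p ∉ Set.range B.part)

/-- `B` is a copy of the monic `B^{cd}` (relative to the background colours `α`): a monic
with exactly one vertex in every part, `E_{01}`-colour `c`, `E_{12}`-colour `d`, and
`E_{ij}`-colour `α i j` for every other pair of distinct parts. -/
def IsBcd (B : LGraph L) (α : Fin m → Fin m → ℕ) (c d : ℕ) : Prop :=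
  B.Monic ∧ (∀ i : Fin m, ∃ x : B.V, B.part x = i) ∧
  (∀ x y : B.V, B.part x = 0 → B.part y = 1 → B.colour x y = c) ∧
  (∀ x y : B.V, B.part x = 1 → B.part y = 2 → B.colour x y = d) ∧
  (∀ x y : B.V, B.part x ≠ B.part y →
    ¬((B.part x = 0 ∧ B.part y = 1) ∨ (B.part x = 1 ∧ B.part y = 0)) →
    ¬((B.part x = 1 ∧ B.part y = 2) ∨ (B.part x = 2 ∧ B.part y = 1)) →
    B.colour x y = α (B.part x) (B.part y))

end Parts01

/-- A proper induced subgraph omitting one vertex `w` is realized by a total function. -/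
theorem LGraph.MinOmitted.exists_map {m : ℕ} {L : MLang m} {G A : LGraph L}
    (hA : G.MinOmitted A) (w x : A.V) (hxw : x ≠ w) :
    ∃ f : A.V → G.V, (∀ a b, a ≠ w → b ≠ w → f a = f b → a = b) ∧
      (∀ a, a ≠ w → G.part (f a) = A.part a) ∧
      ∀ a b, a ≠ w → b ≠ w → A.part a ≠ A.part b → G.colour (f a) (f b) = A.colour a b := by
  classical
  have hne : {a : A.V | a ≠ w} ≠ Set.univ := by
    intro h
    have : w ∈ {a : A.V | a ≠ w} := h ▸ Set.mem_univ w
    exact this rfl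
  obtain ⟨f, hinj, hpart, hcol⟩ := hA.2.2 _ hne
  refine ⟨fun a => if h : a ≠ w then f ⟨a, h⟩ else f ⟨x, hxw⟩, ?_, ?_, ?_⟩
  · intro a b ha hb hab
    simp only [dif_pos ha, dif_pos hb] at hab
    exact congrArg Subtype.val (hinj hab)
  · intro a ha
    simp only [dif_pos ha]
    exact hpart ⟨a, ha⟩
  · intro a b ha hb hab
    simp only [dif_pos ha, dif_pos hb]
    exact hcol ⟨a, ha⟩ ⟨b, hb⟩ hab

/-- Two edges sharing a vertex have the same colour, by amalgamating two vertex-deleted subgraphs. -/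
theorem LGraph.MinOmitted.colour_eq {m : ℕ} {L : MLang m} {G A : LGraph L}
    (hG : G.Homogeneous) (hA : G.MinOmitted A) (x y y' : A.V)
    (hy : A.part y = A.part y') (hxy : A.part x ≠ A.part y) :
    A.colour x y = A.colour x y' := by
  classical
  by_contra hc
  have hyy : y ≠ y' := fun h => hc (h ▸ rfl)
  have hx1 : x ≠ y := fun h => hxy (h ▸ rfl)
  have hx2 : x ≠ y' := fun h => hxy (by rw [h, hy])
  obtain ⟨f, finj, fpart, fcol⟩ := hA.exists_map y x hx1
  obtain ⟨g, ginj, gpart, gcol⟩ := hA.exists_map y' x hx2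
  have : Nonempty A.V := ⟨x⟩
  have : Finite A.V := hA.1
  let T : Set A.V := {z | z ≠ y ∧ z ≠ y'}
  have hinj : Set.InjOn g T := fun a ha b hb h => ginj a b ha.2 hb.2 h
  have hinv : ∀ z ∈ T, Function.invFunOn g T (g z) = z := fun z hz =>
    hinj.leftInvOn_invFunOn hz
  obtain ⟨ψ, ψpart, ψcol, ψext⟩ := hG (g '' T) (Set.toFinite _)
    (fun v => f (Function.invFunOn g T v)) (by
      refine ⟨?_, ?_, ?_⟩
      · rintro _ ⟨a, ha, rfl⟩ _ ⟨b, hb, rfl⟩ h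
        simp only [hinv a ha, hinv b hb] at h
        rw [finj a b ha.1 hb.1 h]
      · rintro _ ⟨a, ha, rfl⟩
        simp only [hinv a ha]
        rw [fpart a ha.1, gpart a ha.2]
      · rintro _ ⟨a, ha, rfl⟩ _ ⟨b, hb, rfl⟩ h
        simp only [hinv a ha, hinv b hb]
        rw [gpart a ha.2, gpart b hb.2] at h
        rw [fcol a b ha.1 hb.1 h, gcol a b ha.2 hb.2 h])
  have hψ : ∀ z, z ≠ y → z ≠ y' → ψ (g z) = f z := by
    intro z h1 h2
    rw [ψext (g z) ⟨z, ⟨h1, h2⟩, rfl⟩]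
    simp only [hinv z ⟨h1, h2⟩]
  have hpy : G.part (ψ (g y)) = A.part y := by rw [ψpart, gpart y hyy]
  have hnew : ∀ z, z ≠ y → f z ≠ ψ (g y) := by
    intro z hz h
    by_cases hz' : z = y'
    · subst hz'
      apply hc
      have h1 : G.colour (f x) (f z) = A.colour x z := fcol x z hx1 hz (hy ▸ hxy)
      have h2 : G.colour (ψ (g x)) (ψ (g y)) = A.colour x y := by
        rw [ψcol _ _ (by rw [gpart x hx2, gpart y hyy]; exact hxy), gcol x y hx2 hyy hxy]
      rw [hψ x hx1 hx2, ← h] at h2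
      exact h2.symm.trans h1
    · rw [← hψ z hz hz'] at h
      exact hz (ginj z y hz' hyy (ψ.injective h))
  have hcolnew : ∀ z, z ≠ y → A.part z ≠ A.part y →
      G.colour (f z) (ψ (g y)) = A.colour z y := by
    intro z hz hp
    have hz' : z ≠ y' := fun h => hp (by rw [h, hy])
    rw [← hψ z hz hz', ψcol _ _ (by rw [gpart z hz', gpart y hyy]; exact hp),
      gcol z y hz' hyy hp]
  apply hA.2.1
  refine ⟨fun z => if z = y then ψ (g y) else f z, ?_, ?_, ?_⟩
  · intro a b h
    by_cases ha : a = y <;> by_cases hb : b = y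
    · rw [ha, hb]
    · simp only [if_pos ha, if_neg hb] at h
      exact absurd h.symm (hnew b hb)
    · simp only [if_neg ha, if_pos hb] at h
      exact absurd h (hnew a ha)
    · simp only [if_neg ha, if_neg hb] at h
      exact finj a b ha hb h
  · intro a
    by_cases ha : a = y
    · simp only [if_pos ha]
      rw [hpy, ha]
    · simp only [if_neg ha]
      exact fpart a ha
  · intro a b h
    by_cases ha : a = y <;> by_cases hb : b = y
    · exact absurd (by rw [ha, hb]) h
    · simp only [if_pos ha, if_neg hb]
      rw [G.colour_symm, A.colour_symm, ha]
      exact hcolnew b hb (fun e => h (by rw [ha, e]))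
    · simp only [if_neg ha, if_pos hb]
      rw [hb]
      exact hcolnew a ha (fun e => h (by rw [hb, e]))
    · simp only [if_neg ha, if_neg hb]
      exact fcol a b ha hb h

/-- Every bipartite restriction of a minimally omitted graph is
monochromatic: any two edges of `A` between the same pair of distinct parts
have the same colour. -/
theorem minOmitted_bipartite_monochromatic
    {m : ℕ} {L : MLang m} (hm : 2 ≤ m)
    (G : LGraph L) (hG : G.Homogeneous) (hgen : G.Generic)
    (A : LGraph L) (hA : G.MinOmitted A)
    (x y x' y' : A.V) (hx : A.part x = A.part x') (hy : A.part y = A.part y')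
    (hxy : A.part x ≠ A.part y) :
    A.colour x y = A.colour x' y' := by
  rw [hA.colour_eq hG x y y' hy hxy, A.colour_symm x y', A.colour_symm x' y']
  exact hA.colour_eq hG y' x x' hx (fun e => hxy (by rw [hy, e]))
end

section
/- Non-monic realization theorem: Let G be a homogeneous m-generic L-graph. Then every graph minimally omitted from G is monic; that is, every A ∈ O(G) has at most one vertex in each part. -/
open LGraph

variable {m : ℕ} {L : MLang m}

namespace LGraph

/-- Genericity, avoiding a finite set of vertices. -/
lemma generic_avoid {m : ℕ} {L : MLang m} (G : LGraph L) (hgen : G.Generic)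
    (i j : Fin m) (hij : i ≠ j) (hC : ∀ c : ℕ, ∃ c' ∈ L.C i j, c' ≠ c) (E : Finset G.V) :
    ∀ U : Finset G.V, (∀ u ∈ U, G.part u = i) → ∀ f : G.V → ℕ, (∀ u ∈ U, f u ∈ L.C i j) →
      ∃ x : G.V, G.part x = j ∧ x ∉ E ∧ ∀ u ∈ U, G.colour x u = f u := by
  classical
  induction E using Finset.induction_on with
  | empty =>
    intro U hU f hf
    obtain ⟨x, hx, h⟩ := hgen.2.2 i j hij U hU f hf
    exact ⟨x, hx, by simp, h⟩
  | insert e E' he ih =>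
    intro U hU f hf
    obtain ⟨z, hz, hzU⟩ := (hgen.2.1 i).exists_notMem_finset U
    obtain ⟨c', hc', hne⟩ := hC (G.colour e z)
    obtain ⟨w, hw, hwE, hwU⟩ := ih (insert z U)
      (by
        intro u hu
        rcases Finset.mem_insert.1 hu with rfl | hu
        · exact hz
        · exact hU u hu)
      (Function.update f z c')
      (by
        intro u hu
        by_cases huz : u = z
        · subst huz; simpa using hc'
        · rw [Function.update_of_ne huz]
          exact hf u ((Finset.mem_insert.1 hu).resolve_left huz))
    refine ⟨w, hw, ?_, ?_⟩
    · intro hmem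
      rcases Finset.mem_insert.1 hmem with rfl | h
      · have := hwU z (Finset.mem_insert_self _ _)
        rw [Function.update_self] at this
        exact hne this.symm
      · exact hwE h
    · intro u hu
      have huz : u ≠ z := by rintro rfl; exact hzU hu
      have := hwU u (Finset.mem_insert_of_mem hu)
      rwa [Function.update_of_ne huz] at this

/-- Homogeneity: move one vertex to a twin over a finite set `D`. -/
lemma move_vertex {m : ℕ} {L : MLang m} (G : LGraph L) (hG : G.Homogeneous)
    (D : Finset G.V) (x x' : G.V) (hx : x ∉ D) (hx' : x' ∉ D) (hp : G.part x' = G.part x)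
    (hc : ∀ d ∈ D, G.part d ≠ G.part x → G.colour x' d = G.colour x d) :
    ∃ ψ : G.V ≃ G.V, (∀ x, G.part (ψ x) = G.part x) ∧
      (∀ x y : G.V, G.part x ≠ G.part y → G.colour (ψ x) (ψ y) = G.colour x y) ∧
      (∀ d ∈ D, ψ d = d) ∧ ψ x = x' := by
  classical
  have hup : ∀ d ∈ D, Function.update (id : G.V → G.V) x x' d = d := by
    intro d hd
    have : d ≠ x := by rintro rfl; exact hx hd
    simp [Function.update_of_ne this]
  have hux : Function.update (id : G.V → G.V) x x' x = x' := by simp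
  obtain ⟨ψ, h1, h2, h3⟩ := hG (↑(insert x D)) (Finset.finite_toSet _)
    (Function.update id x x') (by
      refine ⟨?_, ?_, ?_⟩
      · intro a ha b hb hab
        rcases Finset.mem_insert.1 (Finset.mem_coe.1 ha) with rfl | ka <;>
        rcases Finset.mem_insert.1 (Finset.mem_coe.1 hb) with rfl | kb
        · rfl
        · rw [hux, hup b kb] at hab; subst hab; exact absurd kb hx'
        · rw [hux, hup a ka] at hab; subst hab; exact absurd ka hx'
        · rwa [hup a ka, hup b kb] at hab
      · intro a ha
        rcases Finset.mem_insert.1 (Finset.mem_coe.1 ha) with rfl | ka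
        · rw [hux, hp]
        · rw [hup a ka]
      · intro a ha b hb hab
        rcases Finset.mem_insert.1 (Finset.mem_coe.1 ha) with rfl | ka <;>
        rcases Finset.mem_insert.1 (Finset.mem_coe.1 hb) with rfl | kb
        · exact absurd rfl hab
        · rw [hux, hup b kb, hc b kb hab.symm]
        · rw [hux, hup a ka, G.colour_symm, hc a ka hab, G.colour_symm]
        · rw [hup a ka, hup b kb])
  refine ⟨ψ, h1, h2, ?_, ?_⟩
  · intro d hd
    rw [h3 d (by simp [hd]), hup d hd]
  · rw [h3 x (by simp), hux]

/-- Algebraic closure is trivial in a homogeneous `m`-generic graph. -/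
lemma fibre_infinite {m : ℕ} {L : MLang m} (G : LGraph L) (hG : G.Homogeneous)
    (hgen : G.Generic) (x : G.V) (B : Finset G.V) :
    (∀ b ∈ B, G.part b ≠ G.part x) →
    {t : G.V | G.part t = G.part x ∧ ∀ b ∈ B, G.colour t b = G.colour x b}.Infinite := by
  classical
  induction B using Finset.induction_on with
  | empty =>
    intro _
    simpa using hgen.2.1 (G.part x)
  | insert b D hbD ih =>
    intro hB hSfin
    have hD : ∀ d ∈ D, G.part d ≠ G.part x := fun d hd => hB d (Finset.mem_insert_of_mem hd)
    have hb : G.part b ≠ G.part x := hB b (Finset.mem_insert_self _ _)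
    have hT := ih hD
    obtain ⟨x', hx'T, hx'S⟩ := hT.exists_notMem_finset hSfin.toFinset
    obtain ⟨hx'p, hx'D⟩ := hx'T
    have hmemS : ∀ t, t ∈ hSfin.toFinset ↔ (G.part t = G.part x ∧
        ∀ d ∈ insert b D, G.colour t d = G.colour x d) := by
      intro t; rw [Set.Finite.mem_toFinset]; rfl
    have hcne : G.colour x' b ≠ G.colour x b := by
      intro h
      apply hx'S
      rw [hmemS]
      refine ⟨hx'p, fun d hd => ?_⟩
      rcases Finset.mem_insert.1 hd with rfl | hd
      · exact h
      · exact hx'D d hd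
    have hxD : x ∉ D := fun h => hD x h rfl
    have hx'nD : x' ∉ D := fun h => hD x' h hx'p
    obtain ⟨ψ, ψp, ψc, ψD, ψx⟩ := G.move_vertex hG D x x' hxD hx'nD hx'p
      (fun d hd _ => hx'D d hd)
    have hcx : G.colour x b ∈ L.C (G.part x) (G.part b) := G.colour_mem x b hb.symm
    have hcx' : G.colour x' b ∈ L.C (G.part x) (G.part b) := by
      have := G.colour_mem x' b (by rw [hx'p]; exact hb.symm)
      rwa [hx'p] at this
    -- a separating vertex
    obtain ⟨u, hup, huE, huU⟩ := G.generic_avoid hgen (G.part x) (G.part b) hb.symm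
      (by
        intro c
        by_cases h : G.colour x b = c
        · exact ⟨_, hcx', fun h' => hcne (h'.trans h.symm)⟩
        · exact ⟨_, hcx, h⟩)
      (insert b (insert (ψ b) D)) (insert x' hSfin.toFinset)
      (by
        intro t ht
        rcases Finset.mem_insert.1 ht with rfl | ht
        · exact hx'p
        · exact ((hmemS t).1 ht).1)
      (fun t => if t = x' then G.colour x' b else G.colour x b)
      (by
        intro t _
        split_ifs
        · exact hcx'
        · exact hcx)
    simp only [Finset.mem_insert, not_or] at huE
    obtain ⟨hub, hub', huD⟩ := huE
    have hux' : G.colour u x' = G.colour x' b := by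
      simpa using huU x' (Finset.mem_insert_self _ _)
    have huS : ∀ t ∈ hSfin.toFinset, G.colour u t = G.colour x b := by
      intro t ht
      have h1 := huU t (Finset.mem_insert_of_mem ht)
      have h2 : t ≠ x' := by rintro rfl; exact hx'S ht
      simpa [h2] using h1
    -- move `ψ u` back to `u` over `D` and `ψ b`
    obtain ⟨χ, χp, χc, χD, χu⟩ := G.move_vertex hG (insert (ψ b) D) (ψ u) u
      (by
        intro h
        rcases Finset.mem_insert.1 h with h | h
        · exact hub (ψ.injective h)
        · have := ψD _ h
          exact huD (ψ.injective this ▸ h))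
      (by
        intro h
        rcases Finset.mem_insert.1 h with h | h
        · exact hub' h
        · exact huD h)
      (ψp u).symm
      (by
        intro d hd hdp
        rcases Finset.mem_insert.1 hd with rfl | hd
        · exact absurd (by rw [ψp, ψp, hup]) hdp
        · have := ψc u d (by rw [← ψp u]; exact hdp.symm)
          rw [ψD d hd] at this
          exact this.symm)
    -- the preimage
    obtain ⟨t, ht⟩ := (ψ.trans χ).surjective x'
    have ht' : χ (ψ t) = x' := ht
    have htp : G.part t = G.part x := by
      rw [← hx'p, ← ht', χp, ψp]
    have hcomp : ∀ y z, G.part y ≠ G.part z →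
        G.colour (χ (ψ y)) (χ (ψ z)) = G.colour y z := by
      intro y z hyz
      rw [χc _ _ (by rwa [ψp, ψp]), ψc _ _ hyz]
    have htS : t ∈ hSfin.toFinset := by
      rw [hmemS]
      refine ⟨htp, fun d hd => ?_⟩
      have hdp : G.part t ≠ G.part d := by rw [htp]; exact (hB d hd).symm
      rw [← hcomp t d hdp, ht']
      rcases Finset.mem_insert.1 hd with rfl | hd
      · rw [χD _ (Finset.mem_insert_self _ _), ← ψx, ψc _ _ hb.symm]
      · rw [ψD d hd, χD d (Finset.mem_insert_of_mem hd), hx'D d hd]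
    have h1 := huS t htS
    have h2 := hcomp u t (by rw [hup, htp]; exact hb)
    rw [χu, ht', hux', h1] at h2
    exact hcne h2

/-- A realization of `A` minus a vertex, as a total function. -/
lemma realized_delete {m : ℕ} {L : MLang m} (G A : LGraph L) (y : A.V) (w : G.V)
    (h : G.Realized (A.restrict {z | z ≠ y})) :
    ∃ f : A.V → G.V, Set.InjOn f {z | z ≠ y} ∧ (∀ z, z ≠ y → G.part (f z) = A.part z) ∧
      ∀ z z', z ≠ y → z' ≠ y → A.part z ≠ A.part z' →
        G.colour (f z) (f z') = A.colour z z' := by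
  classical
  obtain ⟨f, hinj, hp, hc⟩ := h
  have key : ∀ z (hz : z ≠ y), (fun z => if h : z ≠ y then f ⟨z, h⟩ else w) z = f ⟨z, hz⟩ := by
    intro z hz
    simp [hz]
  refine ⟨fun z => if h : z ≠ y then f ⟨z, h⟩ else w, ?_, ?_, ?_⟩
  · intro a ha b hb hab
    rw [key a ha, key b hb] at hab
    exact congrArg Subtype.val (hinj hab)
  · intro z hz
    rw [key z hz]
    exact hp ⟨z, hz⟩
  · intro z z' hz hz' hzz
    rw [key z hz, key z' hz']
    exact hc ⟨z, hz⟩ ⟨z', hz'⟩ hzz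

end LGraph

/-- Non-monic realization theorem: every graph minimally omitted from a
homogeneous m-generic L-graph is monic. -/
theorem nonmonic_realization
    {m : ℕ} {L : MLang m} (hm : 2 ≤ m)
    (G : LGraph L) (hG : G.Homogeneous) (hgen : G.Generic) :
    ∀ A : LGraph L, G.MinOmitted A → A.Monic := by
  classical
  intro A hA x y hxy
  by_contra hne
  obtain ⟨hfin, hom, hmin⟩ := hA
  apply hom
  obtain ⟨w, -⟩ := (hgen.2.1 (A.part x)).nonempty
  obtain ⟨f, finj, fp, fc⟩ := G.realized_delete A y w (hmin _ (by
    intro h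
    have : y ∈ {z | z ≠ y} := h ▸ Set.mem_univ y
    exact this rfl))
  obtain ⟨g, ginj, gp, gc⟩ := G.realized_delete A x w (hmin _ (by
    intro h
    have : x ∈ {z | z ≠ x} := h ▸ Set.mem_univ x
    exact this rfl))
  have : Nonempty A.V := ⟨x⟩
  have ginj' : Set.InjOn g {z | z ≠ x ∧ z ≠ y} := ginj.mono (fun z hz => hz.1)
  have hleft := ginj'.leftInvOn_invFunOn
  obtain ⟨ψ, ψp, ψc, ψg⟩ := hG (g '' {z | z ≠ x ∧ z ≠ y}) (Set.toFinite _)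
    (fun v => f (Function.invFunOn g {z | z ≠ x ∧ z ≠ y} v)) (by
      refine ⟨?_, ?_, ?_⟩
      · rintro _ ⟨a, ha, rfl⟩ _ ⟨b, hb, rfl⟩ hab
        dsimp only at hab
        rw [hleft ha, hleft hb] at hab
        rw [finj ha.2 hb.2 hab]
      · rintro _ ⟨a, ha, rfl⟩
        dsimp only
        rw [hleft ha, fp a ha.2, gp a ha.1]
      · rintro _ ⟨a, ha, rfl⟩ _ ⟨b, hb, rfl⟩ hab
        dsimp only
        rw [gp a ha.1, gp b hb.1] at hab
        rw [hleft ha, hleft hb, fc a b ha.2 hb.2 hab, gc a b ha.1 hb.1 hab])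
  have ψg' : ∀ z, z ≠ x → z ≠ y → ψ (g z) = f z := by
    intro z hzx hzy
    rw [ψg _ ⟨z, ⟨hzx, hzy⟩, rfl⟩]
    rw [hleft (show z ∈ {z | z ≠ x ∧ z ≠ y} from ⟨hzx, hzy⟩)]
  have hyx : y ≠ x := fun h => hne h.symm
  have hy0p : G.part (ψ (g y)) = A.part y := by rw [ψp, gp y hyx]
  have hBfin : (f '' {z | A.part z ≠ A.part y}).Finite := Set.toFinite _
  have hinf := G.fibre_infinite hG hgen (ψ (g y)) hBfin.toFinset (by
    intro b hb
    rw [Set.Finite.mem_toFinset] at hb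
    obtain ⟨z, hz, rfl⟩ := hb
    have hzy : z ≠ y := by rintro rfl; exact hz rfl
    rw [hy0p, fp z hzy]
    exact hz)
  obtain ⟨y', ⟨hy'p, hy'c⟩, hy'f⟩ := hinf.exists_notMem_finset (Set.finite_range f).toFinset
  rw [Set.Finite.mem_toFinset] at hy'f
  have hcol : ∀ z, A.part z ≠ A.part y → G.colour y' (f z) = A.colour y z := by
    intro z hz
    have hzy : z ≠ y := by rintro rfl; exact hz rfl
    have hzx : z ≠ x := by rintro rfl; exact hz hxy
    rw [hy'c (f z) (by rw [Set.Finite.mem_toFinset]; exact ⟨z, hz, rfl⟩), ← ψg' z hzx hzy,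
      ψc _ _ (by rw [gp y hyx, gp z hzx]; exact hz.symm), gc y z hyx hzx hz.symm]
  refine ⟨Function.update f y y', ?_, ?_, ?_⟩
  · intro a b hab
    by_cases ha : a = y <;> by_cases hb : b = y
    · rw [ha, hb]
    · subst ha
      rw [Function.update_self, Function.update_of_ne hb] at hab
      exact absurd ⟨b, hab.symm⟩ hy'f
    · subst hb
      rw [Function.update_self, Function.update_of_ne ha] at hab
      exact absurd ⟨a, hab⟩ hy'f
    · rw [Function.update_of_ne ha, Function.update_of_ne hb] at hab
      exact finj ha hb hab
  · intro z
    by_cases hz : z = y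
    · subst hz
      rw [Function.update_self, hy'p, hy0p]
    · rw [Function.update_of_ne hz, fp z hz]
  · intro a b hab
    by_cases ha : a = y <;> by_cases hb : b = y
    · exact absurd (by rw [ha, hb]) hab
    · subst ha
      rw [Function.update_self, Function.update_of_ne hb, hcol b hab.symm]
    · subst hb
      rw [Function.update_self, Function.update_of_ne ha, G.colour_symm, hcol a hab,
        A.colour_symm]
    · rw [Function.update_of_ne ha, Function.update_of_ne hb, fc a b ha hb hab]
end

section
/- Let G be a homogeneous m-generic L-graph and let H be a finite L-graph such that every monic induced subgraph of H is realized in G. Then H is realized in G. -/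
open LGraph

variable {m : ℕ} {L : MLang m}

/-- In a homogeneous generic graph, every realized type over a finite set of vertices
outside the part of `x` is realized infinitely often. -/
theorem infinite_type {m : ℕ} {L : MLang m}
    (G : LGraph L) (hG : G.Homogeneous) (hgen : G.Generic) (x : G.V) (B : Finset G.V) :
    (∀ b ∈ B, G.part b ≠ G.part x) →
    {z : G.V | G.part z = G.part x ∧ ∀ b ∈ B, G.colour z b = G.colour x b}.Infinite := by
  classical
  induction B using Finset.induction_on with
  | empty =>
    intro _
    simpa using hgen.2.1 (G.part x)
  | insert a B haB ih =>
    intro hB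
    have hax : G.part a ≠ G.part x := hB a (Finset.mem_insert_self _ _)
    have hB' : ∀ b ∈ B, G.part b ≠ G.part x := fun b hb => hB b (Finset.mem_insert_of_mem hb)
    have hX := ih hB'
    set X := {z : G.V | G.part z = G.part x ∧ ∀ b ∈ B, G.colour z b = G.colour x b} with hXdef
    set N := {z : G.V | G.part z = G.part x ∧ ∀ b ∈ insert a B, G.colour z b = G.colour x b}
      with hNdef
    have hN : ∀ z, z ∈ N ↔ z ∈ X ∧ G.colour z a = G.colour x a := by
      intro z
      simp only [hNdef, hXdef, Set.mem_ofPred_eq, Finset.mem_insert]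
      constructor
      · rintro ⟨h1, h2⟩
        exact ⟨⟨h1, fun b hb => h2 b (Or.inr hb)⟩, h2 a (Or.inl rfl)⟩
      · rintro ⟨⟨h1, h2⟩, h3⟩
        refine ⟨h1, ?_⟩
        rintro b (rfl | hb)
        · exact h3
        · exact h2 b hb
    by_contra hfin
    have hNfin : N.Finite := Set.not_infinite.mp hfin
    obtain ⟨w, hwX, hwN⟩ := (hX.sdiff hNfin).nonempty
    have hWfin : (insert w N).Finite := hNfin.insert w
    obtain ⟨xs, hxsX, hxsW⟩ := (hX.sdiff hWfin).nonempty
    have hwc : G.colour w a ≠ G.colour x a := fun h => hwN ((hN w).2 ⟨hwX, h⟩)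
    -- the auxiliary vertex
    obtain ⟨y', hy'p, hy'c⟩ := hgen.2.2 (G.part x) (G.part a) (Ne.symm hax)
      (insert xs hWfin.toFinset)
      (by
        intro u hu
        simp only [Finset.mem_insert, Set.Finite.mem_toFinset, Set.mem_insert_iff] at hu
        rcases hu with rfl | rfl | hu
        · exact hxsX.1
        · exact hwX.1
        · exact hu.1)
      (fun u => if u = xs then G.colour w a else G.colour x a)
      (by
        intro u _
        split_ifs
        · have := G.colour_mem w a (by rw [hwX.1]; exact Ne.symm hax)
          rwa [hwX.1] at this
        · exact G.colour_mem x a (Ne.symm hax))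
    have hy'xs : G.colour y' xs = G.colour w a := by
      have := hy'c xs (Finset.mem_insert_self _ _)
      simpa using this
    have hy'W : ∀ u ∈ insert w N, G.colour y' u = G.colour x a := by
      intro u hu
      have h1 := hy'c u (Finset.mem_insert_of_mem (hWfin.mem_toFinset.2 hu))
      have h2 : u ≠ xs := fun h => hxsW (h ▸ hu)
      simpa [h2] using h1
    have hay' : a ≠ y' := by
      intro h
      apply hwc
      rw [G.colour_symm w a]
      conv_lhs => rw [h]
      exact hy'W w (Set.mem_insert _ _)
    have hxB : x ∉ B := fun h => hB' x h rfl
    have hxsB : xs ∉ B := fun h => hB' xs h hxsX.1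
    -- automorphism over `B` moving `x` to `xs`
    obtain ⟨ψ, hψp, hψc, hψ⟩ := hG (insert x (B : Set G.V)) (B.finite_toSet.insert x)
      (fun z => if z = x then xs else z) (by
        refine ⟨?_, ?_, ?_⟩
        · intro u hu v hv huv
          simp only [Set.mem_insert_iff, Finset.mem_coe] at hu hv
          dsimp only at huv
          split_ifs at huv with h1 h2 h2
          · rw [h1, h2]
          · rcases hv with hv | hv
            · exact absurd hv h2
            · exact absurd (huv ▸ hv) hxsB
          · rcases hu with hu | hu
            · exact absurd hu h1
            · exact absurd (huv ▸ hu) hxsB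
          · exact huv
        · intro u hu
          dsimp only
          split_ifs with h1
          · rw [h1]; exact hxsX.1
          · rfl
        · intro u hu v hv huv
          simp only [Set.mem_insert_iff, Finset.mem_coe] at hu hv
          dsimp only
          split_ifs with h1 h2 h2
          · subst h1; subst h2; exact absurd rfl huv
          · rw [h1]; exact hxsX.2 v (hv.resolve_left h2)
          · rw [h2, G.colour_symm u xs, G.colour_symm u x]; exact hxsX.2 u (hu.resolve_left h1)
          · rfl)
    have hψx : ψ x = xs := by simpa using hψ x (Set.mem_insert _ _)
    have hψB : ∀ b ∈ B, ψ b = b := by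
      intro b hb
      have h := hψ b (Set.mem_insert_of_mem _ hb)
      have : b ≠ x := fun h => hxB (h ▸ hb)
      simpa [this] using h
    set y2 := ψ a with hy2
    have hy2p : G.part y2 = G.part a := hψp a
    have hy2xs : G.colour xs y2 = G.colour x a := by
      rw [← hψx]; exact hψc x a (Ne.symm hax)
    have hy2B : y2 ∉ B := by
      intro h
      have : ψ y2 = ψ a := hψB y2 h
      exact haB (ψ.injective this ▸ h)
    have hy2c : ∀ b ∈ B, G.part b ≠ G.part a → G.colour y2 b = G.colour a b := by
      intro b hb hne
      have := hψc a b (Ne.symm hne)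
      rwa [hψB b hb] at this
    have hy2y' : y2 ≠ y' := by
      intro h
      apply hwc
      rw [← hy'xs, ← h, G.colour_symm]
      exact hy2xs
    -- automorphism fixing B and the auxiliary vertex, moving a
    obtain ⟨θ, hθp, hθc, hθ⟩ := hG (insert a (insert y' (B : Set G.V)))
      ((B.finite_toSet.insert y').insert a)
      (fun z => if z = a then y2 else z) (by
        have hne : ∀ u ∈ insert a (insert y' (B : Set G.V)), u ≠ a → y2 ≠ u := by
          rintro u (hu | hu | hu) hua h
          · exact hua hu
          · exact hy2y' (h.trans hu)
          · exact hy2B (h ▸ hu)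
        have hc : ∀ u ∈ insert a (insert y' (B : Set G.V)), G.part u ≠ G.part a →
            G.colour y2 u = G.colour a u := by
          rintro u (hu | hu | hu) hua
          · exact absurd (by rw [hu]) hua
          · exact absurd (by rw [hu, hy'p]) hua
          · exact hy2c u hu hua
        refine ⟨?_, ?_, ?_⟩
        · intro u hu v hv huv
          dsimp only at huv
          split_ifs at huv with h1 h2 h2
          · rw [h1, h2]
          · exact absurd huv (hne v hv h2)
          · exact absurd huv.symm (hne u hu h1)
          · exact huv
        · intro u hu
          dsimp only
          split_ifs with h1
          · rw [h1]; exact hy2p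
          · rfl
        · intro u hu v hv huv
          dsimp only
          split_ifs with h1 h2 h2
          · rw [h1, h2] at huv; exact absurd rfl huv
          · rw [h1]; rw [h1] at huv; exact hc v hv (Ne.symm huv)
          · rw [h2, G.colour_symm u y2, G.colour_symm u a]
            rw [h2] at huv
            exact hc u hu huv
          · rfl)
    have hθa : θ a = y2 := by simpa using hθ a (Set.mem_insert _ _)
    have hθy' : θ y' = y' := by
      have := hθ y' (by simp)
      simpa [Ne.symm hay'] using this
    have hθB : ∀ b ∈ B, θ b = b := by
      intro b hb
      have h := hθ b (by simp [hb])
      have : b ≠ a := fun h => haB (h ▸ hb)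
      simpa [this] using h
    set t := θ.symm xs with ht
    have hθt : θ t = xs := by simp [ht]
    have htp : G.part t = G.part x := by
      rw [← hθp t, hθt]; exact hxsX.1
    have htN : t ∈ N := by
      rw [hN]
      refine ⟨⟨htp, ?_⟩, ?_⟩
      · intro b hb
        have := hθc t b (by rw [htp]; exact Ne.symm (hB' b hb))
        rw [hθt, hθB b hb] at this
        rw [← this]
        exact hxsX.2 b hb
      · have := hθc t a (by rw [htp]; exact Ne.symm hax)
        rw [hθt, hθa] at this
        rw [← this, hy2xs]
    have h1 := hy'W t (Set.mem_insert_of_mem _ htN)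
    have h2 := hθc y' t (by rw [htp, hy'p]; exact hax)
    rw [hθt, hθy', hy'xs, h1] at h2
    exact hwc h2

/-- If all monic induced subgraphs of a finite graph `H` are realized in a
homogeneous m-generic graph `G`, then `H` is realized in `G`. -/
theorem realized_of_all_monic_subgraphs_realized
    {m : ℕ} {L : MLang m} (hm : 2 ≤ m)
    (G : LGraph L) (hG : G.Homogeneous) (hgen : G.Generic)
    (H : LGraph L) (hfin : Finite H.V)
    (hmonic : ∀ S : Set H.V, (H.restrict S).Monic → G.Realized (H.restrict S)) :
    G.Realized H := by
  classical
  have hne : Nonempty G.V := ((hgen.2.1 ⟨0, by omega⟩).nonempty).to_type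
  have := Fintype.ofFinite H.V
  have key : ∀ S : Finset H.V, ∃ f : H.V → G.V, Set.InjOn f S ∧
      (∀ x ∈ S, G.part (f x) = H.part x) ∧
      ∀ x ∈ S, ∀ y ∈ S, H.part x ≠ H.part y → G.colour (f x) (f y) = H.colour x y := by
    intro S
    induction S using Finset.strongInduction with
    | H S ih =>
    by_cases hS : (H.restrict (S : Set H.V)).Monic
    · obtain ⟨f, hf1, hf2, hf3⟩ := hmonic _ hS
      refine ⟨fun z => if h : z ∈ S then f ⟨z, h⟩ else hne.some, ?_, ?_, ?_⟩
      · intro u hu v hv huv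
        have hu' : u ∈ S := hu
        have hv' : v ∈ S := hv
        simp only [hu', hv', dif_pos] at huv
        exact congrArg Subtype.val (hf1 huv)
      · intro u hu
        simp only [hu, dif_pos]
        exact hf2 _
      · intro u hu v hv huv
        simp only [hu, hv, dif_pos]
        exact hf3 ⟨u, hu⟩ ⟨v, hv⟩ huv
    · have hS' : ∃ x ∈ S, ∃ y ∈ S, H.part x = H.part y ∧ x ≠ y := by
        by_contra hcon
        push Not at hcon
        apply hS
        intro x y hxy
        exact Subtype.ext (hcon x.1 x.2 y.1 y.2 hxy)
      obtain ⟨x, hx, y, hy, hxy, hxney⟩ := hS'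
      have hneH : Nonempty H.V := ⟨x⟩
      obtain ⟨f, hf1, hf2, hf3⟩ := ih (S.erase x) (Finset.erase_ssubset hx)
      obtain ⟨g, hg1, hg2, hg3⟩ := ih (S.erase y) (Finset.erase_ssubset hy)
      set T := (S.erase x).erase y with hT
      have hTf : ∀ z ∈ T, z ∈ S.erase x := fun z hz => Finset.mem_of_mem_erase hz
      have hTg : ∀ z ∈ T, z ∈ S.erase y := by
        intro z hz
        simp only [hT, Finset.mem_erase] at hz ⊢
        exact ⟨hz.1, hz.2.2⟩
      have hxg : x ∈ S.erase y := Finset.mem_erase.2 ⟨hxney, hx⟩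
      have hgT : Set.InjOn g (T : Set H.V) := fun u hu v hv h => hg1 (hTg u hu) (hTg v hv) h
      have hinv : ∀ z ∈ T, Function.invFunOn g (T : Set H.V) (g z) = z := fun z hz =>
        hgT (Function.invFunOn_mem ⟨z, hz, rfl⟩) hz (Function.invFunOn_eq ⟨z, hz, rfl⟩)
      obtain ⟨ψ, hψp, hψc, hψ⟩ := hG (g '' (T : Set H.V)) (T.finite_toSet.image g)
        (fun z => f (Function.invFunOn g (T : Set H.V) z)) (by
          refine ⟨?_, ?_, ?_⟩
          · rintro _ ⟨u, hu, rfl⟩ _ ⟨v, hv, rfl⟩ huv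
            dsimp only at huv
            rw [hinv u hu, hinv v hv] at huv
            rw [hf1 (hTf u hu) (hTf v hv) huv]
          · rintro _ ⟨u, hu, rfl⟩
            dsimp only
            rw [hinv u hu, hf2 u (hTf u hu), hg2 u (hTg u hu)]
          · rintro _ ⟨u, hu, rfl⟩ _ ⟨v, hv, rfl⟩ huv
            dsimp only
            rw [hg2 u (hTg u hu), hg2 v (hTg v hv)] at huv
            rw [hinv u hu, hinv v hv, hf3 u (hTf u hu) v (hTf v hv) huv,
              hg3 u (hTg u hu) v (hTg v hv) huv])
      have hψf : ∀ z ∈ T, ψ (g z) = f z := by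
        intro z hz
        rw [hψ (g z) ⟨z, hz, rfl⟩, hinv z hz]
      have hpx : G.part (ψ (g x)) = H.part x := by rw [hψp, hg2 x hxg]
      have hinf := infinite_type G hG hgen (ψ (g x))
        ((T.filter (fun z => H.part z ≠ H.part x)).image f) (by
          intro b hb
          obtain ⟨z, hz, rfl⟩ := Finset.mem_image.1 hb
          rw [Finset.mem_filter] at hz
          rw [hpx, hf2 z (hTf z hz.1)]
          exact hz.2)
      obtain ⟨x', ⟨hx'p, hx'c⟩, hx'n⟩ :=
        (hinf.sdiff (((S.erase x).image f).finite_toSet)).nonempty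
      have hx'f : ∀ z ∈ S, z ≠ x → f z ≠ x' := by
        intro z hz hzx h
        apply hx'n
        rw [← h]
        exact Finset.mem_coe.2 (Finset.mem_image_of_mem f (Finset.mem_erase.2 ⟨hzx, hz⟩))
      have hcol : ∀ z ∈ S, H.part z ≠ H.part x → G.colour x' (f z) = H.colour x z := by
        intro z hz hzx
        have hzT : z ∈ T := by
          simp only [hT, Finset.mem_erase]
          refine ⟨?_, ?_, hz⟩
          · rintro rfl; exact hzx hxy.symm
          · rintro rfl; exact hzx rfl
        rw [hx'c (f z) (Finset.mem_image_of_mem f (Finset.mem_filter.2 ⟨hzT, hzx⟩)),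
          ← hψf z hzT, hψc, hg3 x hxg z (hTg z hzT) (Ne.symm hzx)]
        rw [hg2 x hxg, hg2 z (hTg z hzT)]
        exact Ne.symm hzx
      refine ⟨fun z => if z = x then x' else f z, ?_, ?_, ?_⟩
      · intro u hu v hv huv
        dsimp only at huv
        split_ifs at huv with h1 h2 h2
        · rw [h1, h2]
        · exact absurd huv.symm (hx'f v hv h2)
        · exact absurd huv (hx'f u hu h1)
        · exact hf1 (Finset.mem_coe.2 (Finset.mem_erase.2 ⟨h1, hu⟩))
            (Finset.mem_coe.2 (Finset.mem_erase.2 ⟨h2, hv⟩)) huv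
      · intro u hu
        dsimp only
        split_ifs with h1
        · rw [h1, hx'p, hpx]
        · exact hf2 u (Finset.mem_erase.2 ⟨h1, hu⟩)
      · intro u hu v hv huv
        dsimp only
        split_ifs with h1 h2 h2
        · rw [h1, h2] at huv; exact absurd rfl huv
        · rw [h1]; rw [h1] at huv; exact hcol v hv (Ne.symm huv)
        · rw [h2, G.colour_symm, H.colour_symm u x]
          rw [h2] at huv
          exact hcol u hu huv
        · exact hf3 u (Finset.mem_erase.2 ⟨h1, hu⟩) v (Finset.mem_erase.2 ⟨h2, hv⟩) huv
  obtain ⟨f, hf1, hf2, hf3⟩ := key Finset.univ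
  refine ⟨f, ?_, fun x => hf2 x (Finset.mem_univ _),
    fun x y h => hf3 x (Finset.mem_univ _) y (Finset.mem_univ _) h⟩
  intro u v huv
  exact hf1 (by simp) (by simp) huv
end

section
/- Let G be a homogeneous 3-generic L-graph (so m = 3). Then for each pair of distinct i, j ∈ {0,1,2}, the class O(G) covers at most |C_{ij}| − 1 colours on the restriction V_iV_j; that is, there is at least one colour c ∈ C_{ij} which is not covered on V_iV_j by any member of O(G). -/
open LGraph

variable {m : ℕ} {L : MLang m}

namespace TriFree

theorem generic_infinite {m : ℕ} {L : MLang m} (G : LGraph L) (hgen : G.Generic)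
    (i j : Fin m) (hij : i ≠ j) (U : Finset G.V) (hU : ∀ u ∈ U, G.part u = i)
    (f : G.V → ℕ) (hf : ∀ u ∈ U, f u ∈ L.C i j) :
    {x : G.V | G.part x = j ∧ ∀ u ∈ U, G.colour x u = f u}.Infinite := by
  classical
  by_cases hc : ∃ c ∈ L.C i j, ∃ c' ∈ L.C i j, c ≠ c'
  · obtain ⟨c, hc, c', hc', hcc⟩ := hc
    intro hfin
    have hE : ({x : G.V | G.part x = i} \ (U : Set G.V)).Infinite :=
      (hgen.2.1 i).sdiff U.finite_toSet
    obtain ⟨T, hT, hTc⟩ := hE.exists_subset_card_eq (hfin.toFinset.card + 1)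
    have key : ∀ e : G.V, ∃ x : G.V, G.part x = j ∧ ∀ u ∈ U ∪ T, G.colour x u =
        if u ∈ U then f u else if u = e then c else c' := by
      intro e
      apply hgen.2.2 i j hij (U ∪ T)
      · intro u hu
        rcases Finset.mem_union.1 hu with h | h
        · exact hU u h
        · exact (hT h).1
      · intro u hu
        split_ifs with h1 h2
        · exact hf u h1
        · exact hc
        · exact hc'
    choose g hg1 hg2 using key
    have := Finset.card_le_card_of_injOn (s := T) (t := hfin.toFinset) g
      (by
        intro e he
        simp only [Set.Finite.coe_toFinset, Set.mem_ofPred_eq]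
        refine ⟨hg1 e, fun u hu => ?_⟩
        rw [hg2 e u (Finset.mem_union_left _ hu), if_pos hu])
      (by
        intro e he e' he' h
        by_contra hne
        have h1 := hg2 e e (Finset.mem_union_right _ he)
        have h2 := hg2 e' e (Finset.mem_union_right _ he)
        have hn : e ∉ U := fun h => (hT he).2 h
        rw [if_neg hn, if_pos rfl] at h1
        rw [if_neg hn, if_neg hne] at h2
        rw [h] at h1
        exact hcc (h1.symm.trans h2))
    omega
  · push Not at hc
    refine (hgen.2.1 j).mono ?_
    intro x hx
    refine ⟨hx, fun u hu => ?_⟩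
    refine hc _ ?_ _ (hf u hu)
    have := G.colour_mem x u (by rw [hx, hU u hu]; exact hij.symm)
    rw [hx, hU u hu, L.symm] at this
    exact this

theorem hom_move {m : ℕ} {L : MLang m} (G : LGraph L) (hG : G.Homogeneous)
    (R : Set G.V) (hR : R.Finite) (w w' : G.V) (hw : w ∉ R) (hw' : w' ∉ R)
    (hp : G.part w' = G.part w)
    (hc : ∀ r ∈ R, G.part w ≠ G.part r → G.colour w' r = G.colour w r) :
    ∃ ψ : G.V ≃ G.V, (∀ x, G.part (ψ x) = G.part x) ∧
      (∀ x y : G.V, G.part x ≠ G.part y → G.colour (ψ x) (ψ y) = G.colour x y) ∧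
      (∀ x ∈ R, ψ x = x) ∧ ψ w = w' := by
  classical
  have hne : ∀ r ∈ R, Function.update id w w' r = r := by
    intro r hr
    have : r ≠ w := fun h => hw (h ▸ hr)
    simp [Function.update_of_ne this]
  have heq : Function.update id w w' w = w' := by simp
  obtain ⟨ψ, h1, h2, h3⟩ := hG (insert w R) (hR.insert w) (Function.update id w w') (by
    refine ⟨?_, ?_, ?_⟩
    · rintro x (rfl | hx) y (rfl | hy) h
      · rfl
      · rw [heq, hne y hy] at h
        exact absurd (h ▸ hy) hw'
      · rw [heq, hne x hx] at h
        exact absurd (h ▸ hx) hw'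
      · rwa [hne x hx, hne y hy] at h
    · rintro x (rfl | hx)
      · rw [heq, hp]
      · rw [hne x hx]
    · rintro x (rfl | hx) y (rfl | hy) h
      · exact absurd rfl h
      · rw [heq, hne y hy]
        exact hc y hy h
      · rw [heq, hne x hx, G.colour_symm, hc x hx h.symm, G.colour_symm]
      · rw [hne x hx, hne y hy])
  refine ⟨ψ, h1, h2, fun x hx => ?_, ?_⟩
  · rw [h3 x (Or.inr hx), hne x hx]
  · rw [h3 w (Or.inl rfl), heq]

theorem no_alg {m : ℕ} {L : MLang m} (G : LGraph L) (hG : G.Homogeneous) (hgen : G.Generic)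
    (i j k : Fin m) (hij : i ≠ j) (hik : i ≠ k) (hjk : j ≠ k) (u : G.V) (hu : G.part u = i)
    (P Q : Finset G.V) (hP : ∀ p ∈ P, G.part p = j) (hQ : ∀ q ∈ Q, G.part q = k) :
    {x : G.V | G.part x = i ∧ (∀ p ∈ P, G.colour x p = G.colour u p) ∧
      ∀ q ∈ Q, G.colour x q = G.colour u q}.Infinite := by
  classical
  intro hfin
  have hZ : {x : G.V | G.part x = i ∧ ∀ q ∈ Q, G.colour x q = G.colour u q}.Infinite := by
    refine generic_infinite G hgen k i hik.symm Q hQ (fun q => G.colour u q) ?_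
    intro q hq
    have := G.colour_mem u q (by rw [hu, hQ q hq]; exact hik)
    rw [hu, hQ q hq, L.symm] at this
    exact this
  by_cases hc : ∃ c ∈ L.C i j, ∃ c' ∈ L.C i j, c ≠ c'
  swap
  · push Not at hc
    refine hZ (hfin.subset ?_)
    rintro x ⟨hx, hx2⟩
    refine ⟨hx, fun p hp => ?_, hx2⟩
    have key : ∀ y, G.part y = i → G.colour y p ∈ L.C i j := by
      intro y hy
      have := G.colour_mem y p (by rw [hy, hP p hp]; exact hij)
      rwa [hy, hP p hp] at this
    exact hc _ (key x hx) _ (key u hu)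
  obtain ⟨c, hc, c', hc', hcc⟩ := hc
  let z : ℕ → G.V := fun n => (hZ.natEmbedding _ n : G.V)
  have hzinj : Function.Injective z := fun a b h =>
    (hZ.natEmbedding _).injective (Subtype.ext h)
  have hz : ∀ n, G.part (z n) = i ∧ ∀ q ∈ Q, G.colour (z n) q = G.colour u q :=
    fun n => (hZ.natEmbedding _ n).2
  have hnQ : ∀ x, G.part x = i → x ∉ (Q : Set G.V) := by
    intro x hx hq
    exact hik (hx.symm.trans (hQ x hq))
  have hψ : ∀ n, ∃ ψ : G.V ≃ G.V, (∀ x, G.part (ψ x) = G.part x) ∧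
      (∀ x y : G.V, G.part x ≠ G.part y → G.colour (ψ x) (ψ y) = G.colour x y) ∧
      (∀ x ∈ (Q : Set G.V), ψ x = x) ∧ ψ u = z n := by
    intro n
    refine hom_move G hG (Q : Set G.V) Q.finite_toSet u (z n) (hnQ u hu) (hnQ _ (hz n).1)
      ((hz n).1.trans hu.symm) ?_
    intro r hr _
    exact (hz n).2 r hr
  choose ψ hψ1 hψ2 hψ3 hψ4 using hψ
  let N : ℕ → Set G.V := fun n => {x | G.part x = i ∧
    (∀ p ∈ P, G.colour x (ψ n p) = G.colour u p) ∧ ∀ q ∈ Q, G.colour x q = G.colour u q}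
  have hNfin : ∀ n, (N n).Finite := by
    intro n
    refine (hfin.image (ψ n)).subset ?_
    rintro x ⟨h1, h2, h3⟩
    have hpx : G.part ((ψ n).symm x) = i := by
      rw [← hψ1 n ((ψ n).symm x), Equiv.apply_symm_apply, h1]
    refine ⟨(ψ n).symm x, ⟨hpx, ?_, ?_⟩, by simp⟩
    · intro p hp
      rw [← hψ2 n _ p (by rw [hpx, hP p hp]; exact hij), Equiv.apply_symm_apply, h2 p hp]
    · intro q hq
      rw [← hψ2 n _ q (by rw [hpx, hQ q hq]; exact hik), Equiv.apply_symm_apply,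
        hψ3 n q hq, h3 q hq]
  have hzN : ∀ n, z n ∈ N n := by
    intro n
    refine ⟨(hz n).1, fun p hp => ?_, (hz n).2⟩
    rw [← hψ4 n, hψ2 n u p (by rw [hu, hP p hp]; exact hij)]
  let t := Fintype.card (Q → L.C j k)
  let U : Finset G.V := (Finset.range (t + 1)).biUnion fun n => (hNfin n).toFinset
  have hNU : ∀ n < t + 1, ∀ x ∈ N n, x ∈ U := by
    intro n hn x hx
    exact Finset.mem_biUnion.2 ⟨n, Finset.mem_range.2 hn, (hNfin n).mem_toFinset.2 hx⟩
  have hUi : ∀ x ∈ U, G.part x = i := by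
    intro x hx
    obtain ⟨n, _, h⟩ := Finset.mem_biUnion.1 hx
    exact ((hNfin n).mem_toFinset.1 h).1
  let B : Finset G.V := (Finset.range (t + 1)).biUnion fun n => P.image (ψ n)
  let f : ℕ → G.V → ℕ := fun a x => if ∃ n < a, z n = x then c else c'
  have hw : ∀ a : ℕ, ∃ w : G.V, G.part w = j ∧ (∀ x ∈ U, G.colour w x = f a x) ∧ w ∉ B := by
    intro a
    have := generic_infinite G hgen i j hij U hUi (f a) (by
      intro x _
      dsimp only [f]
      split_ifs
      · exact hc
      · exact hc')
    obtain ⟨w, hw, hwB⟩ := this.exists_notMem_finset B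
    exact ⟨w, hw.1, hw.2, hwB⟩
  choose w hw1 hw2 hw3 using hw
  have hmem : ∀ a, ∀ q : Q, G.colour (w a) q ∈ L.C j k := by
    intro a q
    have := G.colour_mem (w a) q (by rw [hw1, hQ q q.2]; exact hjk)
    rwa [hw1, hQ q q.2] at this
  have hpig : ∃ a b : Fin (t + 1), a < b ∧
      ∀ q ∈ Q, G.colour (w a) q = G.colour (w b) q := by
    obtain ⟨a, b, hab, h⟩ := Fintype.exists_ne_map_eq_of_card_lt
      (fun (a : Fin (t + 1)) (q : Q) => (⟨G.colour (w a) q, hmem a q⟩ : L.C j k))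
      (by rw [Fintype.card_fin]; exact Nat.lt_succ_self _)
    have h' : ∀ q ∈ Q, G.colour (w a) q = G.colour (w b) q := by
      intro q hq
      have := congrFun h ⟨q, hq⟩
      exact congrArg Subtype.val this
    rcases lt_or_gt_of_ne hab with h1 | h1
    · exact ⟨a, b, h1, h'⟩
    · exact ⟨b, a, h1, fun q hq => (h' q hq).symm⟩
  obtain ⟨⟨a, ha⟩, ⟨b, hb⟩, hab, hq⟩ := hpig
  simp only [Fin.mk_lt_mk] at hab
  dsimp only at hq
  have hwR : ∀ e, w e ∉ ((Q : Set G.V) ∪ (P.image (ψ a) : Finset G.V)) := by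
    rintro e (h | h)
    · exact hjk ((hw1 e).symm.trans (hQ _ h))
    · exact hw3 e (Finset.mem_biUnion.2 ⟨a, Finset.mem_range.2 ha, h⟩)
  obtain ⟨ρ, hρ1, hρ2, hρ3, hρ4⟩ := hom_move G hG
    ((Q : Set G.V) ∪ (P.image (ψ a) : Finset G.V))
    (Q.finite_toSet.union (Finset.finite_toSet _)) (w b) (w a) (hwR b) (hwR a)
    (by rw [hw1, hw1]) (by
      rintro r (h | h) hne
      · exact hq r h
      · obtain ⟨p, hp, rfl⟩ := Finset.mem_image.1 h
        rw [hw1, hψ1, hP p hp] at hne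
        exact absurd rfl hne)
  have hρN : ∀ x ∈ N a, ρ x ∈ N a := by
    rintro x ⟨h1, h2, h3⟩
    refine ⟨(hρ1 x).trans h1, fun p hp => ?_, fun q hq => ?_⟩
    · have h := hρ2 x (ψ a p) (by rw [h1, hψ1, hP p hp]; exact hij)
      rw [hρ3 _ (Or.inr (Finset.mem_coe.2 (Finset.mem_image_of_mem _ hp)))] at h
      rw [h, h2 p hp]
    · have h := hρ2 x q (by rw [h1, hQ q hq]; exact hik)
      rw [hρ3 _ (Or.inl hq)] at h
      rw [h, h3 q hq]
  let S : ℕ → Set G.V := fun e => {x | x ∈ N a ∧ G.colour (w e) x = c}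
  have hSfin : ∀ e, (S e).Finite := fun e => (hNfin a).subset fun x hx => hx.1
  have h1 : (S b).ncard ≤ (S a).ncard := by
    refine Set.ncard_le_ncard_of_injOn ρ ?_ ρ.injective.injOn (hSfin a)
    rintro x ⟨hx, hxc⟩
    refine ⟨hρN x hx, ?_⟩
    rw [← hρ4, hρ2 (w b) x (by rw [hw1, hx.1]; exact hij.symm), hxc]
  have h2 : (S a).ncard < (S b).ncard := by
    refine Set.ncard_lt_ncard ?_ (hSfin b)
    rw [Set.ssubset_iff_exists]
    refine ⟨?_, z a, ⟨hzN a, ?_⟩, ?_⟩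
    · rintro x ⟨hx, hxc⟩
      refine ⟨hx, ?_⟩
      rw [hw2 a x (hNU a ha x hx)] at hxc
      rw [hw2 b x (hNU a ha x hx)]
      dsimp only [f] at hxc ⊢
      split_ifs at hxc with h
      · obtain ⟨n, hn, h⟩ := h
        rw [if_pos ⟨n, hn.trans hab, h⟩]
      · exact absurd hxc.symm hcc
    · rw [hw2 b _ (hNU a ha _ (hzN a))]
      exact if_pos ⟨a, hab, rfl⟩
    · rintro ⟨_, h⟩
      rw [hw2 a _ (hNU a ha _ (hzN a))] at h
      dsimp only [f] at h
      rw [if_neg] at h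
      · exact hcc h.symm
      · rintro ⟨n, hn, h⟩
        exact hn.ne (hzinj h)
  omega

theorem third (i j : Fin 3) (h : i ≠ j) : ∃ k : Fin 3, i ≠ k ∧ j ≠ k ∧
    ∀ l, l = i ∨ l = j ∨ l = k := by
  revert i j
  decide

theorem no_alg' {L : MLang 3} (G : LGraph L) (hG : G.Homogeneous) (hgen : G.Generic)
    (u : G.V) (D : Finset G.V) :
    {x : G.V | G.part x = G.part u ∧
      (∀ d ∈ D, G.part u ≠ G.part d → G.colour x d = G.colour u d)}.Infinite := by
  classical
  obtain ⟨j, hj⟩ : ∃ j : Fin 3, G.part u ≠ j := by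
    generalize G.part u = i
    revert i
    decide
  obtain ⟨k, h1, h2, h3⟩ := third (G.part u) j hj
  refine (no_alg G hG hgen (G.part u) j k hj h1 h2 u rfl (D.filter fun d => G.part d = j)
    (D.filter fun d => G.part d = k) (fun p hp => (Finset.mem_filter.1 hp).2)
    (fun p hp => (Finset.mem_filter.1 hp).2)).mono ?_
  rintro x ⟨hx, hP, hQ⟩
  refine ⟨hx, fun d hd hne => ?_⟩
  rcases h3 (G.part d) with h | h | h
  · exact absurd h.symm hne
  · exact hP d (Finset.mem_filter.2 ⟨hd, h⟩)
  · exact hQ d (Finset.mem_filter.2 ⟨hd, h⟩)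

theorem monic {L : MLang 3} (G : LGraph L) (hG : G.Homogeneous) (hgen : G.Generic)
    (A : LGraph L) (hA : G.MinOmitted A) : A.Monic := by
  classical
  intro u v huv
  by_contra hne
  obtain ⟨hfin, hom, hmin⟩ := hA
  obtain ⟨e, he1, he2, he3⟩ := hmin {u}ᶜ (by
    intro h
    have : u ∈ ({u}ᶜ : Set A.V) := h ▸ Set.mem_univ u
    exact this rfl)
  obtain ⟨e', he1', he2', he3'⟩ := hmin {v}ᶜ (by
    intro h
    have : v ∈ ({v}ᶜ : Set A.V) := h ▸ Set.mem_univ v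
    exact this rfl)
  change (({u}ᶜ : Set A.V) → G.V) at e
  change (({v}ᶜ : Set A.V) → G.V) at e'
  replace he1 : ∀ x y : ({u}ᶜ : Set A.V), e x = e y → x.1 = y.1 :=
    fun x y h => congrArg Subtype.val (he1 h : x = y)
  replace he1' : ∀ x y : ({v}ᶜ : Set A.V), e' x = e' y → x.1 = y.1 :=
    fun x y h => congrArg Subtype.val (he1' h : x = y)
  replace he2 : ∀ x : ({u}ᶜ : Set A.V), G.part (e x) = A.part x.1 := he2
  replace he2' : ∀ x : ({v}ᶜ : Set A.V), G.part (e' x) = A.part x.1 := he2'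
  replace he3 : ∀ x y : ({u}ᶜ : Set A.V), A.part x.1 ≠ A.part y.1 →
    G.colour (e x) (e y) = A.colour x.1 y.1 := he3
  replace he3' : ∀ x y : ({v}ᶜ : Set A.V), A.part x.1 ≠ A.part y.1 →
    G.colour (e' x) (e' y) = A.colour x.1 y.1 := he3'
  let g : {x : A.V // x ≠ u ∧ x ≠ v} → G.V := fun x => e ⟨x.1, x.2.1⟩
  let g' : {x : A.V // x ≠ u ∧ x ≠ v} → G.V := fun x => e' ⟨x.1, x.2.2⟩
  have hg : Function.Injective g := fun x y h => by
    exact Subtype.ext (he1 _ _ h)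
  have hg' : Function.Injective g' := fun x y h => by
    exact Subtype.ext (he1' _ _ h)
  have hext : ∀ x, Function.extend g' g id (g' x) = g x := fun x => hg'.extend_apply _ _ _
  obtain ⟨ψ, h1, h2, h3⟩ := hG (Set.range g') (Set.finite_range g')
    (Function.extend g' g id) (by
      refine ⟨?_, ?_, ?_⟩
      · rintro _ ⟨x, rfl⟩ _ ⟨y, rfl⟩ h
        rw [hext, hext] at h
        rw [hg h]
      · rintro _ ⟨x, rfl⟩
        rw [hext]
        exact (he2 ⟨x.1, x.2.1⟩).trans (he2' ⟨x.1, x.2.2⟩).symm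
      · rintro _ ⟨x, rfl⟩ _ ⟨y, rfl⟩ h
        rw [hext, hext]
        have hp : A.part x.1 ≠ A.part y.1 := by
          intro h'
          exact h ((he2' ⟨x.1, x.2.2⟩).trans (h'.trans (he2' ⟨y.1, y.2.2⟩).symm))
        exact (he3 ⟨x.1, x.2.1⟩ ⟨y.1, y.2.1⟩ hp).trans
          (he3' ⟨x.1, x.2.2⟩ ⟨y.1, y.2.2⟩ hp).symm)
  let u' : G.V := ψ (e' ⟨u, hne⟩)
  have hu' : G.part u' = A.part u := (h1 _).trans (he2' _)
  have hψg : ∀ x, ψ (g' x) = g x := fun x => by rw [h3 _ ⟨x, rfl⟩, hext]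
  have hcu : ∀ x, A.part u ≠ A.part x.1 → G.colour u' (g x) = A.colour u x.1 := by
    intro x hx
    rw [← hψg x, h2 _ _ (by
      intro h
      exact hx ((he2' _).symm.trans (h.trans (he2' _))))]
    exact he3' _ _ hx
  have hD : (Set.range e).Finite := Set.finite_range e
  obtain ⟨y, ⟨hy1, hy2⟩, hy3⟩ :=
    (no_alg' G hG hgen u' hD.toFinset).exists_notMem_finset hD.toFinset
  have hy4 : ∀ x, e x ≠ y := fun x h => hy3 (hD.mem_toFinset.2 ⟨x, h⟩)
  have hyc : ∀ x : A.V, ∀ hx : x ≠ u, A.part u ≠ A.part x →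
      G.colour y (e ⟨x, hx⟩) = A.colour u x := by
    intro x hx hp
    have hxv : x ≠ v := fun h => hp (h ▸ huv)
    rw [hy2 _ (hD.mem_toFinset.2 ⟨_, rfl⟩) (by
      intro h
      exact hp (hu'.symm.trans (h.trans (he2 _))))]
    exact hcu ⟨x, hx, hxv⟩ hp
  apply hom
  let F : A.V → G.V := fun x => if h : x = u then y else e ⟨x, h⟩
  have hFu : F u = y := by simp [F]
  have hFx : ∀ x, ∀ h : x ≠ u, F x = e ⟨x, h⟩ := fun x h => by simp [F, h]
  refine ⟨F, ?_, ?_, ?_⟩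
  · intro x x' h
    by_cases hx : x = u <;> by_cases hx' : x' = u
    · rw [hx, hx']
    · rw [hx, hFu, hFx x' hx'] at h
      exact absurd h.symm (hy4 _)
    · rw [hx', hFu, hFx x hx] at h
      exact absurd h (hy4 _)
    · rw [hFx x hx, hFx x' hx'] at h
      exact he1 _ _ h
  · intro x
    by_cases hx : x = u
    · rw [hx, hFu, hy1, hu']
    · rw [hFx x hx]
      exact he2 _
  · intro x x' hp
    by_cases hx : x = u <;> by_cases hx' : x' = u
    · rw [hx, hx'] at hp
      exact absurd rfl hp
    · subst hx
      rw [hFu, hFx x' hx']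
      exact hyc x' hx' hp
    · subst hx'
      rw [hFu, hFx x hx, G.colour_symm, A.colour_symm]
      exact hyc x hx hp.symm
    · rw [hFx x hx, hFx x' hx']
      exact he3 _ _ hp

/-- An embedding criterion: a monic graph embeds once representatives for the parts are found. -/
theorem realize_monic {m : ℕ} {L : MLang m} (G A : LGraph L) (hA : A.Monic) (r : Fin m → G.V)
    (hr : ∀ x : A.V, G.part (r (A.part x)) = A.part x)
    (hc : ∀ x y : A.V, A.part x ≠ A.part y →
      G.colour (r (A.part x)) (r (A.part y)) = A.colour x y) : G.Realized A := by
  refine ⟨fun x => r (A.part x), ?_, hr, hc⟩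
  intro x y h
  apply hA
  dsimp only at h
  rw [← hr x, ← hr y, h]

/-- Each minimally omitted graph covering `c` on `V_i V_j` yields an omitted triangle. -/
theorem omitted_triangle {L : MLang 3} (G : LGraph L) (hG : G.Homogeneous) (hgen : G.Generic)
    (i j k : Fin 3) (hij : i ≠ j) (hik : i ≠ k) (hjk : j ≠ k)
    (hall : ∀ l, l = i ∨ l = j ∨ l = k) (c : ℕ)
    (A : LGraph L) (hA : G.MinOmitted A) (hcov : A.Covers i j c) :
    ∃ a ∈ L.C k i, ∃ b ∈ L.C k j, ∀ X Y W : G.V, G.part X = i → G.part Y = j → G.part W = k →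
      G.colour X W = a → G.colour Y W = b → G.colour X Y ≠ c := by
  classical
  have hm := monic G hG hgen A hA
  obtain ⟨x, y, hx, hy, hxy⟩ := hcov
  -- a representative function
  have hreal : ∀ X Y W : G.V, G.part X = i → G.part Y = j → G.part W = k →
      G.colour X Y = c → (∀ w, A.part w = k → G.colour X W = A.colour x w ∧
        G.colour Y W = A.colour y w) → False := by
    intro X Y W hX hY hW hXY hw
    apply hA.2.1
    let r : Fin 3 → G.V := fun l => if l = i then X else if l = j then Y else W
    have ri : r i = X := by simp [r]
    have rj : r j = Y := by simp [r, hij.symm]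
    have rk : r k = W := by simp [r, hik.symm, hjk.symm]
    refine realize_monic G A hm r ?_ ?_
    · intro v
      rcases hall (A.part v) with h | h | h <;> rw [h]
      · rw [ri, hX]
      · rw [rj, hY]
      · rw [rk, hW]
    · intro v v' hp
      rcases hall (A.part v) with h | h | h <;> rcases hall (A.part v') with h' | h' | h' <;>
        rw [h, h'] at hp ⊢ <;> try exact absurd rfl hp
      · rw [ri, rj, hm v x (h.trans hx.symm), hm v' y (h'.trans hy.symm), hXY, hxy]
      · rw [ri, rk, hm v x (h.trans hx.symm), (hw v' h').1]
      · rw [ri, rj, hm v y (h.trans hy.symm), hm v' x (h'.trans hx.symm), G.colour_symm, hXY,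
          A.colour_symm, hxy]
      · rw [rj, rk, hm v y (h.trans hy.symm), (hw v' h').2]
      · rw [ri, rk, hm v' x (h'.trans hx.symm), G.colour_symm, (hw v h).1, A.colour_symm]
      · rw [rj, rk, hm v' y (h'.trans hy.symm), G.colour_symm, (hw v h).2, A.colour_symm]
  by_cases hw : ∃ w, A.part w = k
  · obtain ⟨w, hw⟩ := hw
    refine ⟨A.colour x w, ?_, A.colour y w, ?_, ?_⟩
    · have := A.colour_mem w x (by rw [hw, hx]; exact hik.symm)
      rwa [hw, hx, A.colour_symm] at this
    · have := A.colour_mem w y (by rw [hw, hy]; exact hjk.symm)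
      rwa [hw, hy, A.colour_symm] at this
    · intro X Y W hX hY hW hXW hYW hXY
      refine hreal X Y W hX hY hW hXY ?_
      intro w' hw'
      rw [hm w' w (hw'.trans hw.symm)]
      exact ⟨hXW, hYW⟩
  · exfalso
    have hcm : c ∈ L.C i j := by
      have := A.colour_mem x y (by rw [hx, hy]; exact hij)
      rwa [hx, hy, hxy] at this
    obtain ⟨X, hX⟩ := (hgen.2.1 i).nonempty
    obtain ⟨W, hW⟩ := (hgen.2.1 k).nonempty
    obtain ⟨Y, hY, hYc⟩ := hgen.2.2 i j hij {X} (by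
      intro u hu
      rw [Finset.mem_singleton.1 hu]
      exact hX) (fun _ => c) (fun _ _ => hcm)
    refine hreal X Y W hX hY hW ?_ ?_
    · rw [G.colour_symm]
      exact hYc X (Finset.mem_singleton_self X)
    · intro w h
      exact absurd ⟨w, h⟩ hw

end TriFree

/-- In a homogeneous 3-generic graph, for each pair of distinct parts
`i, j` some colour of `C_{ij}` is not covered on `V_i V_j` by any member of `O(G)`. -/
theorem tripartite_free_colour
    {L : MLang 3} (G : LGraph L) (hG : G.Homogeneous) (hgen : G.Generic) :
    ∀ i j : Fin 3, i ≠ j →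
      ∃ c ∈ L.C i j, ∀ A : LGraph L, G.MinOmitted A → ¬ A.Covers i j c := by
  classical
  intro i j hij
  obtain ⟨k, hik, hjk, hall⟩ := TriFree.third i j hij
  by_contra hcon
  push Not at hcon
  have key : ∀ c : ℕ, ∃ a b : ℕ, c ∈ L.C i j → a ∈ L.C k i ∧ b ∈ L.C k j ∧
      ∀ X Y W : G.V, G.part X = i → G.part Y = j → G.part W = k →
      G.colour X W = a → G.colour Y W = b → G.colour X Y ≠ c := by
    intro c
    by_cases hc : c ∈ L.C i j
    · obtain ⟨A, hA, hcov⟩ := hcon c hc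
      obtain ⟨a, ha, b, hb, h⟩ :=
        TriFree.omitted_triangle G hG hgen i j k hij hik hjk hall c A hA hcov
      exact ⟨a, b, fun _ => ⟨ha, hb, h⟩⟩
    · exact ⟨0, 0, fun h => absurd h hc⟩
  choose a b hab using key
  have hV := hgen.2.1 k
  let w : ℕ → G.V := fun n => (hV.natEmbedding _ n : G.V)
  have hwinj : Function.Injective w := fun n n' h =>
    (hV.natEmbedding _).injective (Subtype.ext h)
  have hw : ∀ n, G.part (w n) = k := fun n => (hV.natEmbedding _ n).2
  have hinv : ∀ n, Function.invFun w (w n) = n := Function.leftInverse_invFun hwinj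
  have hU : ∀ u ∈ (L.C i j).image w, G.part u = k := by
    intro u hu
    obtain ⟨n, _, rfl⟩ := Finset.mem_image.1 hu
    exact hw n
  obtain ⟨X, hX, hXc⟩ := hgen.2.2 k i hik.symm ((L.C i j).image w) hU
    (fun u => a (Function.invFun w u)) (by
      intro u hu
      obtain ⟨n, hn, rfl⟩ := Finset.mem_image.1 hu
      rw [hinv]
      exact (hab n hn).1)
  obtain ⟨Y, hY, hYc⟩ := hgen.2.2 k j hjk.symm ((L.C i j).image w) hU
    (fun u => b (Function.invFun w u)) (by
      intro u hu
      obtain ⟨n, hn, rfl⟩ := Finset.mem_image.1 hu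
      rw [hinv]
      exact (hab n hn).2.1)
  have hc : G.colour X Y ∈ L.C i j := by
    have := G.colour_mem X Y (by rw [hX, hY]; exact hij)
    rwa [hX, hY] at this
  have hmem := Finset.mem_image_of_mem w hc
  refine (hab _ hc).2.2 X Y (w (G.colour X Y)) hX hY (hw _) ?_ ?_ rfl
  · rw [hXc _ hmem, hinv]
  · rw [hYc _ hmem, hinv]
end

section
/- Classification of homogeneous 3-generic graphs: let m = 3. (1) If G is a homogeneous 3-generic L-graph, then O(G) is a class of triangles which for each pair of distinct i, j ∈ {0,1,2} covers at most |C_{ij}| − 1 colours on the restriction V_iV_j. (2) Conversely, for every class ℱ of pairwise non-isomorphic triangle L-graphs which for each pair of distinct i, j ∈ {0,1,2} covers at most |C_{ij}| − 1 colours on V_iV_j, the class Forb(ℱ) is an amalgamation class, and there is a countable homogeneous 3-generic L-graph G with O(G) = ℱ. -/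
open LGraph

variable {m : ℕ} {L : MLang m}

/-! ### Triangles and the forbidden patterns -/

/-- The triangle pattern on parts `i j k` with the given colours belongs to `F`. -/
def Bad {L : MLang 3} (F : Set (LGraph L)) (i j k : Fin 3) (a b c : ℕ) : Prop :=
  ∃ A ∈ F, ∃ u v w : A.V, A.part u = i ∧ A.part v = j ∧ A.part w = k ∧
    A.colour u v = a ∧ A.colour u w = b ∧ A.colour v w = c

theorem Bad.swap12 {L : MLang 3} {F : Set (LGraph L)} {i j k : Fin 3} {a b c : ℕ}
    (h : Bad F i j k a b c) : Bad F j i k a c b := by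
  obtain ⟨A, hA, u, v, w, h1, h2, h3, h4, h5, h6⟩ := h
  exact ⟨A, hA, v, u, w, h2, h1, h3, by rw [A.colour_symm, h4], h6, h5⟩

theorem Bad.swap23 {L : MLang 3} {F : Set (LGraph L)} {i j k : Fin 3} {a b c : ℕ}
    (h : Bad F i j k a b c) : Bad F i k j b a c := by
  obtain ⟨A, hA, u, v, w, h1, h2, h3, h4, h5, h6⟩ := h
  exact ⟨A, hA, u, w, v, h1, h3, h2, h5, h4, by rw [A.colour_symm, h6]⟩

def Omits {L : MLang 3} (F : Set (LGraph L)) (B : LGraph L) : Prop :=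
  ∀ x y z : B.V, B.part x ≠ B.part y → B.part x ≠ B.part z → B.part y ≠ B.part z →
    ¬ Bad F (B.part x) (B.part y) (B.part z) (B.colour x y) (B.colour x z) (B.colour y z)

theorem fin3_cover {i j k : Fin 3} (h1 : i ≠ j) (h2 : i ≠ k) (h3 : j ≠ k) (l : Fin 3) :
    l = i ∨ l = j ∨ l = k := by
  revert i j k l; decide

theorem LGraph.IsTriangle.all_parts {L : MLang 3} {A : LGraph L} (h : A.IsTriangle) (l : Fin 3) :
    ∃ x : A.V, A.part x = l := by
  obtain ⟨i, j, k, h1, h2, h3, -, -, hi, hj, hk⟩ := h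
  rcases fin3_cover h1 h2 h3 l with rfl | rfl | rfl <;> assumption

theorem LGraph.IsTriangle.monic {L : MLang 3} {A : LGraph L} (h : A.IsTriangle) : A.Monic := by
  obtain ⟨i, j, k, h1, h2, h3, h, -⟩ := h
  exact h

theorem isTriangle_of {L : MLang 3} {A : LGraph L} (h : A.Monic)
    (h' : ∀ l, ∃ x : A.V, A.part x = l) : A.IsTriangle :=
  ⟨0, 1, 2, by decide, by decide, by decide, h,
    fun x => fin3_cover (by decide) (by decide) (by decide) _, h' 0, h' 1, h' 2⟩

theorem omits_iff {L : MLang 3} {F : Set (LGraph L)} (hF : ∀ A ∈ F, A.IsTriangle)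
    (B : LGraph L) : Omits F B ↔ ∀ A ∈ F, ¬ B.Realized A := by
  constructor
  · rintro h A hA ⟨f, hinj, hp, hc⟩
    obtain ⟨u, hu⟩ := (hF A hA).all_parts 0
    obtain ⟨v, hv⟩ := (hF A hA).all_parts 1
    obtain ⟨w, hw⟩ := (hF A hA).all_parts 2
    refine h (f u) (f v) (f w) ?_ ?_ ?_ ⟨A, hA, u, v, w, ?_, ?_, ?_, ?_, ?_, ?_⟩
    all_goals simp [hp, hu, hv, hw, hc]
  · rintro h x y z hxy hxz hyz ⟨A, hA, u, v, w, h1, h2, h3, h4, h5, h6⟩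
    have hm := (hF A hA).monic
    have key : ∀ t : A.V, t = u ∨ t = v ∨ t = w := by
      intro t
      rcases fin3_cover hxy hxz hyz (A.part t) with e | e | e
      · exact Or.inl (hm _ _ (e.trans h1.symm))
      · exact Or.inr (Or.inl (hm _ _ (e.trans h2.symm)))
      · exact Or.inr (Or.inr (hm _ _ (e.trans h3.symm)))
    have huv : u ≠ v := by rintro rfl; exact hxy (h1.symm.trans h2)
    have huw : u ≠ w := by rintro rfl; exact hxz (h1.symm.trans h3)
    have hvw : v ≠ w := by rintro rfl; exact hyz (h2.symm.trans h3)
    classical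
    let f : A.V → B.V := fun t => if t = u then x else if t = v then y else z
    have fu : f u = x := by simp [f]
    have fv : f v = y := by simp [f, huv.symm]
    have fw : f w = z := by simp [f, huw.symm, hvw.symm]
    have fp : ∀ t, B.part (f t) = A.part t := by
      intro t
      rcases key t with rfl | rfl | rfl
      · rw [fu, h1]
      · rw [fv, h2]
      · rw [fw, h3]
    refine h A hA ⟨f, ?_, fp, ?_⟩
    · intro s t hst
      apply hm
      rw [← fp, ← fp, hst]
    · intro s t hst
      rcases key s with rfl | rfl | rfl <;> rcases key t with rfl | rfl | rfl <;>
        first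
        | exact absurd rfl hst
        | (simp only [fu, fv, fw, h4, h5, h6]; done)
        | (rw [A.colour_symm, B.colour_symm]; simp only [fu, fv, fw, h4, h5, h6]; done)

/-! ### Construction of the limit -/

/-- One-point extension property. -/
def ExtProp {L : MLang 3} (F : Set (LGraph L)) (G : LGraph L) : Prop :=
  ∀ (S : Finset G.V) (i : Fin 3) (f : G.V → ℕ),
    (∀ s ∈ S, i ≠ G.part s → f s ∈ L.C i (G.part s)) →
    (∀ s ∈ S, ∀ t ∈ S, i ≠ G.part s → i ≠ G.part t → G.part s ≠ G.part t →
      ¬ Bad F i (G.part s) (G.part t) (f s) (f t) (G.colour s t)) →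
    ∃ x, x ∉ S ∧ G.part x = i ∧ ∀ s ∈ S, i ≠ G.part s → G.colour x s = f s

open Classical in
/-- The recursively defined colouring on `ℕ`. -/
noncomputable def limCol {L : MLang 3} (F : Set (LGraph L)) (d : Fin 3 → Fin 3 → ℕ)
    (p : ℕ → Fin 3) (g : ℕ → ℕ → ℕ) (n m : ℕ) : ℕ :=
  if (∀ a, (ha : a < n) → ∀ b, b < a → g n a ≠ 0 → g n b ≠ 0 → p a ≠ p b →
      ¬ Bad F (p n) (p a) (p b) (g n a - 1) (g n b - 1) (limCol F d p g a b)) ∧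
    (∀ a, a < n → g n a ≠ 0 → p n ≠ p a → g n a - 1 ∈ L.C (p n) (p a)) ∧ g n m ≠ 0 then
    g n m - 1
  else d (p n) (p m)
termination_by n

theorem limCol_cases {L : MLang 3} (F : Set (LGraph L)) (d : Fin 3 → Fin 3 → ℕ)
    (p : ℕ → Fin 3) (g : ℕ → ℕ → ℕ) (n : ℕ) :
    (∀ m, limCol F d p g n m = d (p n) (p m)) ∨
    ((∀ a, a < n → ∀ b, b < a → g n a ≠ 0 → g n b ≠ 0 → p a ≠ p b →
      ¬ Bad F (p n) (p a) (p b) (g n a - 1) (g n b - 1) (limCol F d p g a b)) ∧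
    (∀ a, a < n → g n a ≠ 0 → p n ≠ p a → g n a - 1 ∈ L.C (p n) (p a)) ∧
    ∀ m, limCol F d p g n m = if g n m ≠ 0 then g n m - 1 else d (p n) (p m)) := by
  classical
  by_cases h : (∀ a, a < n → ∀ b, b < a → g n a ≠ 0 → g n b ≠ 0 → p a ≠ p b →
      ¬ Bad F (p n) (p a) (p b) (g n a - 1) (g n b - 1) (limCol F d p g a b)) ∧
    (∀ a, a < n → g n a ≠ 0 → p n ≠ p a → g n a - 1 ∈ L.C (p n) (p a))
  · right
    refine ⟨h.1, h.2, fun m => ?_⟩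
    rw [limCol]
    by_cases hm : g n m ≠ 0
    · rw [if_pos ⟨h.1, h.2, hm⟩, if_pos hm]
    · rw [if_neg (fun h => hm h.2.2), if_neg hm]
  · left
    intro m
    rw [limCol, if_neg (fun h' => h ⟨h'.1, h'.2.1⟩)]

theorem limCol_eq {L : MLang 3} (F : Set (LGraph L)) (d : Fin 3 → Fin 3 → ℕ)
    (p : ℕ → Fin 3) (g : ℕ → ℕ → ℕ) (n : ℕ)
    (h1 : ∀ a, a < n → ∀ b, b < a → g n a ≠ 0 → g n b ≠ 0 → p a ≠ p b →
      ¬ Bad F (p n) (p a) (p b) (g n a - 1) (g n b - 1) (limCol F d p g a b))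
    (h2 : ∀ a, a < n → g n a ≠ 0 → p n ≠ p a → g n a - 1 ∈ L.C (p n) (p a))
    (m : ℕ) (hm : g n m ≠ 0) : limCol F d p g n m = g n m - 1 := by
  rw [limCol, if_pos ⟨h1, h2, hm⟩]

theorem limCol_mem {L : MLang 3} (F : Set (LGraph L)) (d : Fin 3 → Fin 3 → ℕ)
    (hd : ∀ i j, i ≠ j → d i j ∈ L.C i j)
    (p : ℕ → Fin 3) (g : ℕ → ℕ → ℕ) (n m : ℕ) (hm : m < n) (hp : p n ≠ p m) :
    limCol F d p g n m ∈ L.C (p n) (p m) := by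
  rcases limCol_cases F d p g n with h | ⟨-, h2, h3⟩
  · rw [h]; exact hd _ _ hp
  · rw [h3]
    split_ifs with h
    · exact h2 m hm h hp
    · exact hd _ _ hp

theorem limCol_bad {L : MLang 3} (F : Set (LGraph L)) (d : Fin 3 → Fin 3 → ℕ)
    (hbad : ∀ i j k a b c, i ≠ j → i ≠ k → j ≠ k → Bad F i j k a b c → a ≠ d i j)
    (p : ℕ → Fin 3) (g : ℕ → ℕ → ℕ) (n a b : ℕ) (ha : a < n) (hb : b < a)
    (h1 : p n ≠ p a) (h2 : p n ≠ p b) (h3 : p a ≠ p b) :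
    ¬ Bad F (p n) (p a) (p b) (limCol F d p g n a) (limCol F d p g n b)
      (limCol F d p g a b) := by
  intro hB
  have e1 := hbad _ _ _ _ _ _ h1 h2 h3 hB
  have e2 := hbad _ _ _ _ _ _ h2 h1 h3.symm hB.swap23
  rcases limCol_cases F d p g n with h | ⟨k1, -, k3⟩
  · exact e1 (h _)
  · rw [k3 a] at e1 hB
    rw [k3 b] at e2 hB
    by_cases ga : g n a ≠ 0
    · by_cases gb : g n b ≠ 0
      · rw [if_pos ga, if_pos gb] at hB
        exact k1 a ha b hb ga gb h3 hB
      · rw [if_neg gb] at e2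
        exact e2 rfl
    · rw [if_neg ga] at e1
      exact e1 rfl

/-- The limit graph on `ℕ`. -/
noncomputable def limGraph {L : MLang 3} (F : Set (LGraph L)) (d : Fin 3 → Fin 3 → ℕ)
    (hd : ∀ i j, i ≠ j → d i j ∈ L.C i j) (p : ℕ → Fin 3) (g : ℕ → ℕ → ℕ) : LGraph L where
  V := ℕ
  part := p
  colour x y := if y < x then limCol F d p g x y else if x < y then limCol F d p g y x else 0
  colour_symm x y := by
    rcases lt_trichotomy x y with h | h | h
    · simp [h, not_lt_of_gt h]
    · simp [h]
    · simp [h, not_lt_of_gt h]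
  colour_mem x y hxy := by
    rcases lt_trichotomy x y with h | h | h
    · simp only [h, not_lt_of_gt h, if_true, if_false]
      rw [L.symm]
      exact limCol_mem F d hd p g y x h hxy.symm
    · exact absurd (congrArg p h) hxy
    · simp only [h, if_true]
      exact limCol_mem F d hd p g x y h hxy

theorem exists_limit {L : MLang 3} (F : Set (LGraph L)) (d : Fin 3 → Fin 3 → ℕ)
    (hd : ∀ i j, i ≠ j → d i j ∈ L.C i j)
    (hbad : ∀ i j k a b c, i ≠ j → i ≠ k → j ≠ k → Bad F i j k a b c → a ≠ d i j) :
    ∃ G : LGraph L, Countable G.V ∧ Omits F G ∧ ExtProp F G := by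
  classical
  obtain ⟨req, hreq⟩ := exists_surjective_nat ((Fin 3 × (ℕ →₀ ℕ)) × ℕ)
  have hinf : ∀ (r : Fin 3 × (ℕ →₀ ℕ)) (N : ℕ), ∃ n, N ≤ n ∧ (req n).1 = r := by
    intro r N
    by_contra hcon
    push Not at hcon
    have : Set.Finite {n | (req n).1 = r} := by
      apply (Set.finite_lt_nat N).subset
      intro n hn
      by_contra h
      exact hcon n (not_lt.mp h) hn
    have h2 := this.image req
    apply Set.infinite_range_of_injective (f := fun k : ℕ => (r, k))
      (fun a b h => (Prod.mk.inj h).2)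
    apply h2.subset
    rintro _ ⟨k, rfl⟩
    obtain ⟨n, hn⟩ := hreq (r, k)
    exact ⟨n, by simp [hn], hn⟩
  let p : ℕ → Fin 3 := fun n => (req n).1.1
  let g : ℕ → ℕ → ℕ := fun n => (req n).1.2
  have hlt : ∀ x y : ℕ, y < x → (limGraph F d hd p g).colour x y = limCol F d p g x y := by
    intro x y h
    simp [limGraph, h]
  refine ⟨limGraph F d hd p g, (inferInstance : Countable ℕ), ?_, ?_⟩
  · have main : ∀ x y z : ℕ, y < x → z < y → p x ≠ p y → p x ≠ p z → p y ≠ p z →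
        ¬ Bad F (p x) (p y) (p z) ((limGraph F d hd p g).colour x y)
          ((limGraph F d hd p g).colour x z) ((limGraph F d hd p g).colour y z) := by
      intro x y z h1 h2 h3 h4 h5
      rw [hlt x y h1, hlt x z (h2.trans h1), hlt y z h2]
      exact limCol_bad F d hbad p g x y z h1 h2 h3 h4 h5
    intro x y z hxy hxz hyz hB
    change ℕ at x y z
    have hs := (limGraph F d hd p g).colour_symm
    change p x ≠ p y at hxy
    change p x ≠ p z at hxz
    change p y ≠ p z at hyz
    change Bad F (p x) (p y) (p z) _ _ _ at hB
    have n1 : x ≠ y := fun h => hxy (congrArg p h)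
    have n2 : x ≠ z := fun h => hxz (congrArg p h)
    have n3 : y ≠ z := fun h => hyz (congrArg p h)
    rcases lt_or_gt_of_ne n1 with h1 | h1 <;> rcases lt_or_gt_of_ne n2 with h2 | h2 <;>
      rcases lt_or_gt_of_ne n3 with h3 | h3
    · -- x < y < z
      refine main z y x h3 h1 hyz.symm hxz.symm hxy.symm ?_
      rw [hs z y, hs z x, hs y x]
      exact hB.swap23.swap12.swap23
    · -- x < z < y
      refine main y z x h3 h2 hyz hxy.symm hxz.symm ?_
      rw [hs y x, hs z x]
      exact hB.swap12.swap23
    · omega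
    · -- z < x < y
      refine main y x z h1 h2 hxy.symm hyz hxz ?_
      rw [hs y x]
      exact hB.swap12
    · -- y < x < z
      refine main z x y h2 h1 hxz.symm hyz.symm hxy ?_
      rw [hs z x, hs z y]
      exact hB.swap23.swap12
    · omega
    · -- y < z < x
      refine main x z y h2 h3 hxz hxy hyz.symm ?_
      rw [hs z y]
      exact hB.swap23
    · exact main x y z h1 h3 hxy hxz hyz hB
  · intro S i f hf1 hf2
    change Finset ℕ at S
    change ℕ → ℕ at f
    change ∀ s ∈ S, i ≠ p s → f s ∈ L.C i (p s) at hf1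
    change ∀ s ∈ S, ∀ t ∈ S, i ≠ p s → i ≠ p t → p s ≠ p t →
      ¬ Bad F i (p s) (p t) (f s) (f t) _ at hf2
    let r : ℕ →₀ ℕ := Finsupp.onFinset S (fun s => if s ∈ S ∧ i ≠ p s then f s + 1 else 0)
      (by intro a ha; by_contra h; simp [h] at ha)
    obtain ⟨n, hn, hr⟩ := hinf (i, r) (S.sup id + 1)
    have hS : ∀ s ∈ S, s < n := fun s hs =>
      lt_of_le_of_lt (Finset.le_sup (f := id) hs) hn
    have hpn : p n = i := by simp [p, hr]
    have hgn : ∀ s, g n s = if s ∈ S ∧ i ≠ p s then f s + 1 else 0 := by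
      intro s; simp only [g, hr, r, Finsupp.onFinset_apply]
    have hgn' : ∀ s, g n s ≠ 0 → (s ∈ S ∧ i ≠ p s) ∧ g n s - 1 = f s := by
      intro s hs
      rw [hgn] at hs ⊢
      split_ifs at hs ⊢ with h
      · exact ⟨h, by simp⟩
      · exact absurd rfl hs
    refine ⟨n, fun h => lt_irrefl _ (hS n h), hpn, ?_⟩
    intro s hs his
    change i ≠ p s at his
    change ℕ at s
    rw [hlt n s (hS s hs), limCol_eq F d p g n]
    · rw [hgn, if_pos ⟨hs, his⟩]; simp
    · intro a ha b hb ga gb hab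
      obtain ⟨⟨a1, a2⟩, a3⟩ := hgn' a ga
      obtain ⟨⟨b1, b2⟩, b3⟩ := hgn' b gb
      rw [a3, b3, hpn, ← hlt a b hb]
      exact hf2 a a1 b b1 a2 b2 hab
    · intro a ha ga _
      obtain ⟨⟨a1, a2⟩, a3⟩ := hgn' a ga
      rw [a3, hpn]
      exact hf1 a a1 a2
    · rw [hgn, if_pos ⟨hs, his⟩]; simp

/-! ### Partial isomorphisms and back-and-forth -/

/-- A finite relation which is a partial isomorphism between `D` and `G`. -/
def PIso {L : MLang 3} (D G : LGraph L) (R : Finset (D.V × G.V)) : Prop :=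
  ∀ q ∈ R, ∀ r ∈ R, (q.1 = r.1 ↔ q.2 = r.2) ∧ D.part q.1 = G.part q.2 ∧
    (D.part q.1 ≠ D.part r.1 → D.colour q.1 r.1 = G.colour q.2 r.2)

theorem PIso.extend {L : MLang 3} {F : Set (LGraph L)} {D G : LGraph L} (hD : Omits F D)
    (hG : ExtProp F G) {R : Finset (D.V × G.V)} (hR : PIso D G R) (x : D.V) :
    ∃ R', R ⊆ R' ∧ PIso D G R' ∧ ∃ y, (x, y) ∈ R' := by
  classical
  by_cases hx : ∃ y, (x, y) ∈ R
  · exact ⟨R, subset_rfl, hR, hx⟩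
  push Not at hx
  have hinv : ∀ s : G.V, ∃ c : ℕ, ∀ q ∈ R, q.2 = s → c = D.colour x q.1 := by
    intro s
    by_cases hs : ∃ q ∈ R, q.2 = s
    · obtain ⟨q, hq, rfl⟩ := hs
      refine ⟨D.colour x q.1, fun r hr h => ?_⟩
      rw [((hR r hr q hq).1).2 h]
    · exact ⟨0, fun q hq h => absurd ⟨q, hq, h⟩ hs⟩
  choose f hf using hinv
  obtain ⟨y, hyS, hyp, hyc⟩ := hG (R.image Prod.snd) (D.part x) f (by
      intro s hs hps
      obtain ⟨q, hq, rfl⟩ := Finset.mem_image.mp hs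
      rw [hf _ q hq rfl, ← (hR q hq q hq).2.1]
      rw [← (hR q hq q hq).2.1] at hps
      exact D.colour_mem _ _ hps) (by
      intro s hs t ht hps hpt hst
      obtain ⟨q, hq, rfl⟩ := Finset.mem_image.mp hs
      obtain ⟨r, hr, rfl⟩ := Finset.mem_image.mp ht
      rw [hf _ q hq rfl, hf _ r hr rfl]
      rw [← (hR q hq q hq).2.1] at *
      rw [← (hR r hr r hr).2.1] at *
      rw [← (hR q hq r hr).2.2 hst]
      exact hD x q.1 r.1 hps hpt hst)
  refine ⟨insert (x, y) R, Finset.subset_insert _ _, ?_, y, Finset.mem_insert_self _ _⟩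
  have hxR : ∀ q ∈ R, x ≠ q.1 := by
    rintro ⟨a, b⟩ hq rfl
    exact hx b hq
  have hyR : ∀ q ∈ R, y ≠ q.2 := by
    rintro q hq rfl
    exact hyS (Finset.mem_image_of_mem _ hq)
  have hcol : ∀ q ∈ R, D.part x ≠ D.part q.1 → D.colour x q.1 = G.colour y q.2 := by
    intro q hq h
    rw [hyc q.2 (Finset.mem_image_of_mem _ hq) (by rw [← (hR q hq q hq).2.1]; exact h),
      hf _ q hq rfl]
  intro q hq r hr
  rcases Finset.mem_insert.mp hq with rfl | hq <;> rcases Finset.mem_insert.mp hr with rfl | hr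
  · exact ⟨by simp, hyp.symm, fun h => absurd rfl h⟩
  · exact ⟨iff_of_false (hxR r hr) (hyR r hr), hyp.symm, hcol r hr⟩
  · refine ⟨iff_of_false (hxR q hq).symm (hyR q hq).symm, (hR q hq q hq).2.1, fun h => ?_⟩
    rw [D.colour_symm, G.colour_symm]
    exact hcol q hq h.symm
  · exact hR q hq r hr

theorem PIso.swap {L : MLang 3} {D G : LGraph L} {R : Finset (D.V × G.V)} (hR : PIso D G R) :
    PIso G D (R.map (Equiv.prodComm _ _).toEmbedding) := by
  intro q hq r hr
  obtain ⟨q', hq', rfl⟩ := Finset.mem_map.mp hq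
  obtain ⟨r', hr', rfl⟩ := Finset.mem_map.mp hr
  obtain ⟨h1, h2, h3⟩ := hR q' hq' r' hr'
  obtain ⟨-, h5, -⟩ := hR r' hr' q' hq'
  refine ⟨h1.symm, h2.symm, fun h => (h3 ?_).symm⟩
  rw [h2, h5]
  exact h

theorem PIso.extend' {L : MLang 3} {F : Set (LGraph L)} {D G : LGraph L} (hG : Omits F G)
    (hD : ExtProp F D) {R : Finset (D.V × G.V)} (hR : PIso D G R) (y : G.V) :
    ∃ R', R ⊆ R' ∧ PIso D G R' ∧ ∃ x, (x, y) ∈ R' := by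
  obtain ⟨R', h1, h2, x, hx⟩ := hR.swap.extend hG hD y
  refine ⟨R'.map (Equiv.prodComm _ _).toEmbedding, ?_, h2.swap, x, ?_⟩
  · intro q hq
    refine Finset.mem_map.mpr ⟨(q.2, q.1), h1 (Finset.mem_map.mpr ⟨q, hq, rfl⟩), rfl⟩
  · exact Finset.mem_map.mpr ⟨(y, x), hx, rfl⟩

theorem PIso.extend_finset {L : MLang 3} {F : Set (LGraph L)} {D G : LGraph L}
    (hD : Omits F D) (hG : ExtProp F G) {R : Finset (D.V × G.V)} (hR : PIso D G R)
    (S : Finset D.V) : ∃ R', R ⊆ R' ∧ PIso D G R' ∧ ∀ x ∈ S, ∃ y, (x, y) ∈ R' := by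
  classical
  induction S using Finset.induction_on with
  | empty => exact ⟨R, subset_rfl, hR, by simp⟩
  | insert a S _ ih =>
    obtain ⟨R', h1, h2, h3⟩ := ih
    obtain ⟨R'', k1, k2, k3⟩ := h2.extend hD hG a
    refine ⟨R'', h1.trans k1, k2, ?_⟩
    intro x hx
    rcases Finset.mem_insert.mp hx with rfl | hx
    · exact k3
    · obtain ⟨y, hy⟩ := h3 x hx
      exact ⟨y, k1 hy⟩

theorem extend_embedding {L : MLang 3} {F : Set (LGraph L)} {D G : LGraph L} [Finite D.V]
    (hD : Omits F D) (hG : ExtProp F G) {R : Finset (D.V × G.V)} (hR : PIso D G R) :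
    ∃ f : D.V → G.V, IsEmbedding D G f ∧ ∀ q ∈ R, f q.1 = q.2 := by
  cases nonempty_fintype D.V
  obtain ⟨R', h1, h2, h3⟩ := hR.extend_finset hD hG Finset.univ
  choose f hf using fun x => h3 x (Finset.mem_univ x)
  refine ⟨f, ⟨?_, ?_, ?_⟩, ?_⟩
  · intro x y hxy
    exact (h2 _ (hf x) _ (hf y)).1.2 hxy
  · intro x
    exact (h2 _ (hf x) _ (hf x)).2.1.symm
  · intro x y hxy
    exact ((h2 _ (hf x) _ (hf y)).2.2 hxy).symm
  · intro q hq
    exact ((h2 _ (hf q.1) _ (h1 hq)).1).1 rfl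

theorem homogeneous_of_ext {L : MLang 3} {F : Set (LGraph L)} {G : LGraph L} [Countable G.V]
    (hO : Omits F G) (hE : ExtProp F G) : G.Homogeneous := by
  classical
  intro S hS φ ⟨hφ1, hφ2, hφ3⟩
  let P := {R : Finset (G.V × G.V) // PIso G G R}
  let R0 : P := ⟨hS.toFinset.image (fun x => (x, φ x)), by
    intro q hq r hr
    obtain ⟨x, hx, rfl⟩ := Finset.mem_image.mp hq
    obtain ⟨y, hy, rfl⟩ := Finset.mem_image.mp hr
    rw [Set.Finite.mem_toFinset] at hx hy
    exact ⟨⟨fun h => congrArg φ h, fun h => hφ1 hx hy h⟩, (hφ2 x hx).symm,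
      fun h => (hφ3 x hx y hy h).symm⟩⟩
  let e := Encodable.ofCountable (G.V ⊕ G.V)
  let Dn : G.V ⊕ G.V → Order.Cofinal P := fun v => match v with
    | Sum.inl x => ⟨{R | ∃ y, (x, y) ∈ R.1}, fun R => by
        obtain ⟨R', h1, h2, h3⟩ := R.2.extend hO hE x
        exact ⟨⟨R', h2⟩, h3, h1⟩⟩
    | Sum.inr y => ⟨{R | ∃ x, (x, y) ∈ R.1}, fun R => by
        obtain ⟨R', h1, h2, h3⟩ := R.2.extend' hO hE y
        exact ⟨⟨R', h2⟩, h3, h1⟩⟩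
  let I := Order.idealOfCofinals R0 Dn
  have hR0 : R0 ∈ I := Order.mem_idealOfCofinals R0 Dn
  have hl : ∀ x, ∃ y, ∃ R ∈ I, (x, y) ∈ R.1 := by
    intro x
    obtain ⟨R, hR, hRI⟩ := Order.cofinal_meets_idealOfCofinals R0 Dn (Sum.inl x)
    obtain ⟨y, hy⟩ := hR
    exact ⟨y, R, hRI, hy⟩
  have hr : ∀ y, ∃ x, ∃ R ∈ I, (x, y) ∈ R.1 := by
    intro y
    obtain ⟨R, hR, hRI⟩ := Order.cofinal_meets_idealOfCofinals R0 Dn (Sum.inr y)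
    obtain ⟨x, hx⟩ := hR
    exact ⟨x, R, hRI, hx⟩
  have hcomp : ∀ q r : G.V × G.V, (∃ R ∈ I, q ∈ R.1) → (∃ R ∈ I, r ∈ R.1) →
      (q.1 = r.1 ↔ q.2 = r.2) ∧ G.part q.1 = G.part q.2 ∧
      (G.part q.1 ≠ G.part r.1 → G.colour q.1 r.1 = G.colour q.2 r.2) := by
    rintro q r ⟨R, hR, hq⟩ ⟨R', hR', hr⟩
    obtain ⟨T, hT, h1, h2⟩ := I.directed R hR R' hR'
    exact T.2 q (h1 hq) r (h2 hr)
  choose f hf using hl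
  choose g hg using hr
  refine ⟨⟨f, g, ?_, ?_⟩, ?_, ?_, ?_⟩
  · intro x
    exact (hcomp (g (f x), f x) (x, f x) (hg _) (hf _)).1.2 rfl
  · intro y
    exact (hcomp (g y, f (g y)) (g y, y) (hf _) (hg _)).1.1 rfl
  · intro x
    exact (hcomp (x, f x) (x, f x) (hf _) (hf _)).2.1.symm
  · intro x y hxy
    exact ((hcomp (x, f x) (y, f y) (hf _) (hf _)).2.2 hxy).symm
  · intro x hx
    refine (hcomp (x, f x) (x, φ x) (hf _) ⟨R0, hR0, ?_⟩).1.1 rfl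
    exact Finset.mem_image.mpr ⟨x, by simpa using hx, rfl⟩

theorem generic_of_ext {L : MLang 3} {F : Set (LGraph L)} {G : LGraph L} [Countable G.V]
    (d : Fin 3 → Fin 3 → ℕ) (hd : ∀ i j, i ≠ j → d i j ∈ L.C i j)
    (hbad : ∀ i j k a b c, i ≠ j → i ≠ k → j ≠ k → Bad F i j k a b c → a ≠ d i j)
    (hE : ExtProp F G) : G.Generic := by
  refine ⟨inferInstance, ?_, ?_⟩
  · intro i hfin
    obtain ⟨x, hx, hxi, -⟩ := hE hfin.toFinset i (fun s => d i (G.part s))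
      (fun s _ h => hd _ _ h)
      (fun s _ t _ h1 h2 h3 hB => hbad _ _ _ _ _ _ h1 h2 h3 hB rfl)
    exact hx (by simpa using hxi)
  · intro i j hij U hU f hf
    obtain ⟨x, -, hxi, hx⟩ := hE U j f
      (fun s hs _ => by rw [hU s hs, L.symm]; exact hf s hs)
      (fun s hs t ht h1 h2 h3 => absurd ((hU s hs).trans (hU t ht).symm) h3)
    exact ⟨x, hxi, fun u hu => hx u hu (by rw [hU u hu]; exact hij.symm)⟩

theorem LGraph.IsEmbedding.comp {L : MLang 3} {A B C : LGraph L} {f : A.V → B.V} {g : B.V → C.V}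
    (hg : IsEmbedding B C g) (hf : IsEmbedding A B f) : IsEmbedding A C (g ∘ f) := by
  refine ⟨hg.1.comp hf.1, fun x => (hg.2.1 _).trans (hf.2.1 _), fun x y h => ?_⟩
  rw [← hf.2.2 x y h]
  exact hg.2.2 _ _ (by rw [hf.2.1, hf.2.1]; exact h)

theorem LGraph.IsEmbedding.restrict_val {L : MLang 3} (A : LGraph L) (S : Set A.V) :
    IsEmbedding (A.restrict S) A (fun x => x.1) :=
  ⟨fun _ _ h => Subtype.ext h, fun _ => rfl, fun _ _ _ => rfl⟩

theorem Omits.pull {L : MLang 3} {F : Set (LGraph L)} {A B : LGraph L} (h : Omits F B)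
    {f : A.V → B.V} (hf : IsEmbedding A B f) : Omits F A := by
  intro x y z h1 h2 h3
  have := h (f x) (f y) (f z)
  rw [hf.2.1, hf.2.1, hf.2.1, hf.2.2 _ _ h1, hf.2.2 _ _ h2, hf.2.2 _ _ h3] at this
  exact this h1 h2 h3

theorem part_two {L : MLang 3} (F : Set (LGraph L)) (hF : ∀ A ∈ F, A.IsTriangle)
    (hunc : ∀ i j : Fin 3, i ≠ j → ∃ c ∈ L.C i j, ∀ A ∈ F, ¬ A.Covers i j c) :
    IsAmalgamationClass (Forb F) ∧
      ∃ G : LGraph L, Countable G.V ∧ G.Homogeneous ∧ G.Generic ∧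
        ∀ A : LGraph L, G.MinOmitted A ↔ ∃ B ∈ F, B.IsIsomorphic A := by
  classical
  have hd0 : ∀ i j : Fin 3, ∃ c, i ≠ j → c ∈ L.C i j ∧ ∀ A ∈ F, ¬ A.Covers i j c := by
    intro i j
    by_cases h : i = j
    · exact ⟨0, fun h' => absurd h h'⟩
    · obtain ⟨c, h1, h2⟩ := hunc i j h
      exact ⟨c, fun _ => ⟨h1, h2⟩⟩
  choose d hd' using hd0
  have hd : ∀ i j, i ≠ j → d i j ∈ L.C i j := fun i j h => (hd' i j h).1
  have hbad : ∀ i j k a b c, i ≠ j → i ≠ k → j ≠ k → Bad F i j k a b c → a ≠ d i j := by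
    rintro i j k a b c hij - - ⟨A, hA, u, v, w, h1, h2, h3, h4, h5, h6⟩ rfl
    exact (hd' i j hij).2 A hA ⟨u, v, h1, h2, h4⟩
  obtain ⟨G, hcount, hO, hE⟩ := exists_limit F d hd hbad
  have hO' := (omits_iff hF G).mp hO
  have hreal : ∀ D : LGraph L, Finite D.V → Omits F D → G.Realized D := by
    intro D hfin hD
    obtain ⟨f, hf, -⟩ := extend_embedding hD hE (R := ∅) (by intro q hq; simp at hq)
    exact ⟨f, hf⟩
  refine ⟨⟨fun A hA => hA.1, ?_, ?_, ?_⟩, G, hcount, homogeneous_of_ext hO hE,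
    generic_of_ext d hd hbad hE, ?_⟩
  · rintro A ⟨hfin, hA⟩ B ⟨f, hf, hs⟩
    refine ⟨Finite.of_surjective f hs, fun T hT => ?_⟩
    have e : A.V ≃ B.V := Equiv.ofBijective f ⟨hf.1, hs⟩
    rintro ⟨g, hg⟩
    choose k hk using hs
    refine hA T hT ⟨k ∘ g, ?_, ?_, ?_⟩
    · intro x y h
      apply hg.1
      rw [← hk (g x), ← hk (g y)]
      exact congrArg f h
    · intro x
      rw [← hg.2.1 x, ← hf.2.1]
      simp [hk]
    · intro x y h
      rw [← hg.2.2 x y h, ← hf.2.2]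
      · simp [hk]
      · rw [← hf.2.1, ← hf.2.1]
        simp only [Function.comp, hk]
        rw [hg.2.1, hg.2.1]
        exact h
  · rintro A ⟨hfin, hA⟩ S
    refine ⟨inferInstanceAs (Finite S), fun T hT => ?_⟩
    rintro ⟨g, hg⟩
    exact hA T hT ⟨_, (IsEmbedding.restrict_val A S).comp hg⟩
  · rintro A B₁ B₂ hA hB₁ hB₂ f₁ f₂ hf₁ hf₂
    have := hA.1
    have := hB₁.1
    have := hB₂.1
    obtain ⟨h₁, hh₁⟩ := hreal B₁ hB₁.1 ((omits_iff hF _).mpr hB₁.2)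
    cases nonempty_fintype A.V
    have hc := hh₁.comp hf₁
    obtain ⟨h₂, hh₂, hR⟩ := extend_embedding ((omits_iff hF _).mpr hB₂.2) hE
      (R := Finset.univ.image (fun a : A.V => (f₂ a, h₁ (f₁ a)))) (by
        intro q hq r hr
        obtain ⟨x, -, rfl⟩ := Finset.mem_image.mp hq
        obtain ⟨y, -, rfl⟩ := Finset.mem_image.mp hr
        refine ⟨⟨fun h => by rw [hf₂.1 h], fun h => by rw [hc.1 h]⟩,
          (hf₂.2.1 x).trans (hc.2.1 x).symm, fun h => ?_⟩
        rw [hf₂.2.1, hf₂.2.1] at h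
        exact (hf₂.2.2 x y h).trans (hc.2.2 x y h).symm)
    refine ⟨G.restrict (Set.range h₁ ∪ Set.range h₂),
      ⟨((Set.finite_range h₁).union (Set.finite_range h₂)).to_subtype, ?_⟩,
      fun x => ⟨h₁ x, Or.inl ⟨x, rfl⟩⟩, fun x => ⟨h₂ x, Or.inr ⟨x, rfl⟩⟩, ?_, ?_, ?_⟩
    · exact (omits_iff hF _).mp (hO.pull (IsEmbedding.restrict_val G _))
    · exact ⟨fun x y h => hh₁.1 (congrArg Subtype.val h), hh₁.2.1, hh₁.2.2⟩
    · exact ⟨fun x y h => hh₂.1 (congrArg Subtype.val h), hh₂.2.1, hh₂.2.2⟩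
    · funext a
      apply Subtype.ext
      exact (hR (f₂ a, h₁ (f₁ a)) (Finset.mem_image_of_mem _ (Finset.mem_univ a))).symm
  · intro A
    constructor
    · rintro ⟨hfin, homit, hmin⟩
      by_contra hcon
      apply homit
      apply hreal A hfin
      rw [omits_iff hF]
      rintro B hB ⟨f, hf⟩
      apply hcon
      refine ⟨B, hB, f, hf, ?_⟩
      rw [← Set.range_eq_univ]
      by_contra hne
      obtain ⟨g, hg⟩ := hmin _ hne
      refine hO' B hB ⟨_, hg.comp (f := fun b => (⟨f b, b, rfl⟩ : Set.range f)) ?_⟩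
      exact ⟨fun x y h => hf.1 (congrArg Subtype.val h), hf.2.1, hf.2.2⟩
    · rintro ⟨B, hB, f, hf, hs⟩
      have hBm := (hF B hB).monic
      have hfinB : Finite B.V := Finite.of_injective B.part (fun x y h => hBm x y h)
      have hfin : Finite A.V := Finite.of_surjective f hs
      refine ⟨hfin, ?_, ?_⟩
      · rintro ⟨g, hg⟩
        exact hO' B hB ⟨_, hg.comp hf⟩
      · intro S hS
        apply hreal _ (inferInstanceAs (Finite S))
        rw [omits_iff hF]
        rintro T hT ⟨g, hg⟩
        apply hS
        rw [Set.eq_univ_iff_forall]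
        intro a
        obtain ⟨t, ht⟩ := (hF T hT).all_parts (A.part a)
        have hp : A.part (g t).1 = A.part a := (hg.2.1 t).trans ht
        obtain ⟨b, hb⟩ := hs (g t).1
        obtain ⟨b', rfl⟩ := hs a
        have : b = b' := by
          apply hBm
          rw [← hf.2.1, ← hf.2.1, hb, hp]
        rw [← this, hb]
        exact (g t).2

/-! ### Part one -/

theorem Generic.exists_notMem {L : MLang 3} {G : LGraph L} (hG : G.Generic) {i j : Fin 3}
    (hij : i ≠ j) (E : Finset G.V) : ∀ (U : Finset G.V), (∀ u ∈ U, G.part u = i) →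
      ∀ f : G.V → ℕ, (∀ u ∈ U, f u ∈ L.C i j) →
        ∃ x : G.V, x ∉ E ∧ G.part x = j ∧ ∀ u ∈ U, G.colour x u = f u := by
  classical
  by_cases hC : ∃ α ∈ L.C i j, ∃ β ∈ L.C i j, α ≠ β
  · obtain ⟨α, hα, β, hβ, hαβ⟩ := hC
    induction E using Finset.induction_on with
    | empty =>
      intro U hU f hf
      obtain ⟨x, h1, h2⟩ := hG.2.2 i j hij U hU f hf
      exact ⟨x, by simp, h1, h2⟩
    | insert e E _ ih =>
      intro U hU f hf
      obtain ⟨u, hui, huU⟩ := (hG.2.1 i).exists_notMem_finset U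
      obtain ⟨γ, hγ, hne⟩ : ∃ γ ∈ L.C i j, γ ≠ G.colour e u := by
        by_cases h : α = G.colour e u
        · exact ⟨β, hβ, fun h' => hαβ (h.trans h'.symm)⟩
        · exact ⟨α, hα, h⟩
      obtain ⟨x, h1, h2, h3⟩ := ih (insert u U)
        (by
          intro v hv
          rcases Finset.mem_insert.mp hv with rfl | hv
          · exact hui
          · exact hU v hv) (Function.update f u γ)
        (by
          intro v hv
          rcases Finset.mem_insert.mp hv with rfl | hv'
          · simpa using hγ
          · rw [Function.update_of_ne (by rintro rfl; exact huU hv')]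
            exact hf v hv')
      refine ⟨x, ?_, h2, ?_⟩
      · rw [Finset.mem_insert]
        rintro (rfl | h)
        · have := h3 u (Finset.mem_insert_self _ _)
          rw [Function.update_self] at this
          exact hne this.symm
        · exact h1 h
      · intro v hv
        rw [h3 v (Finset.mem_insert_of_mem hv),
          Function.update_of_ne (by rintro rfl; exact huU hv)]
  · push Not at hC
    intro U hU f hf
    obtain ⟨x, hx, hxE⟩ := (hG.2.1 j).exists_notMem_finset E
    have hx : G.part x = j := hx
    refine ⟨x, hxE, hx, fun u hu => hC _ ?_ _ (hf u hu)⟩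
    have := G.colour_mem u x (by rw [hx, hU u hu]; exact hij)
    rwa [hx, hU u hu, G.colour_symm] at this

theorem not_algebraic {L : MLang 3} {G : LGraph L} (hH : G.Homogeneous) (hG : G.Generic)
    {i j k : Fin 3} (hij : i ≠ j) (hik : i ≠ k) (hjk : j ≠ k) (X Y : Finset G.V)
    (hX : ∀ x ∈ X, G.part x = j) (hY : ∀ y ∈ Y, G.part y = k) (a : G.V) (ha : G.part a = i) :
    {s : G.V | G.part s = i ∧ (∀ x ∈ X, G.colour s x = G.colour a x) ∧
      ∀ y ∈ Y, G.colour s y = G.colour a y}.Infinite := by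
  classical
  intro hfin
  set S := {s : G.V | G.part s = i ∧ (∀ x ∈ X, G.colour s x = G.colour a x) ∧
      ∀ y ∈ Y, G.colour s y = G.colour a y} with hS
  obtain ⟨t, htS, hti, htY⟩ := Generic.exists_notMem hG hik.symm hfin.toFinset Y hY
    (fun y => G.colour a y) (by
      intro y hy
      have := G.colour_mem a y (by rw [ha, hY y hy]; exact hik)
      rw [ha, hY y hy] at this
      rw [L.symm]; exact this)
  have htS : t ∉ S := by simpa using htS
  by_cases hC : ∃ α ∈ L.C i j, ∃ β ∈ L.C i j, α ≠ β
  swap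
  · push Not at hC
    apply htS
    refine ⟨hti, fun x hx => hC _ ?_ _ ?_, htY⟩
    · have := G.colour_mem t x (by rw [hti, hX x hx]; exact hij)
      rwa [hti, hX x hx] at this
    · have := G.colour_mem a x (by rw [ha, hX x hx]; exact hij)
      rwa [ha, hX x hx] at this
  obtain ⟨α, hα, β, hβ, hαβ⟩ := hC
  have hYa : ∀ y ∈ Y, y ≠ a := by
    rintro y hy rfl; exact hik (ha.symm.trans (hY y hy))
  have hYt : ∀ y ∈ Y, y ≠ t := by
    rintro y hy rfl; exact hik (hti.symm.trans (hY y hy))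
  obtain ⟨σ, σp, σc, σe⟩ := hH (insert a (Y : Set G.V)) (Y.finite_toSet.insert a)
    (Function.update id a t) (by
      refine ⟨?_, ?_, ?_⟩
      · rintro x (rfl | hx) y (rfl | hy) hxy
        · rfl
        · rw [Function.update_self, Function.update_of_ne (hYa y hy)] at hxy
          exact absurd hxy.symm (hYt y hy)
        · rw [Function.update_self, Function.update_of_ne (hYa x hx)] at hxy
          exact absurd hxy (hYt x hx)
        · rwa [Function.update_of_ne (hYa x hx), Function.update_of_ne (hYa y hy)] at hxy
      · rintro x (rfl | hx)
        · rw [Function.update_self, hti, ha]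
        · rw [Function.update_of_ne (hYa x hx)]; rfl
      · rintro x (rfl | hx) y (rfl | hy) hxy
        · exact absurd rfl hxy
        · rw [Function.update_self, Function.update_of_ne (hYa y hy)]
          exact htY y hy
        · rw [Function.update_self, Function.update_of_ne (hYa x hx), G.colour_symm,
            G.colour_symm x]
          exact htY x hx
        · rw [Function.update_of_ne (hYa x hx), Function.update_of_ne (hYa y hy)]; rfl)
  have σa : σ a = t := by rw [σe a (Or.inl rfl), Function.update_self]
  have σY : ∀ y ∈ Y, σ y = y := by
    intro y hy
    rw [σe y (Or.inr hy), Function.update_of_ne (hYa y hy)]; rfl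
  -- the test vertex
  obtain ⟨w, hwE, hwj, hwc⟩ := Generic.exists_notMem hG hij (X ∪ X.image σ)
    (insert t hfin.toFinset) (by
      intro u hu
      rcases Finset.mem_insert.mp hu with rfl | hu
      · exact hti
      · rw [Set.Finite.mem_toFinset] at hu
        exact hu.1) (fun u => if u = t then β else α) (by
      intro u hu
      split_ifs
      · exact hβ
      · exact hα)
  have hwX : ∀ x ∈ X, σ x ≠ w := by
    rintro x hx rfl
    exact hwE (Finset.mem_union_right _ (Finset.mem_image_of_mem _ hx))
  have hwX' : ∀ x ∈ X, x ≠ w := by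
    rintro x hx rfl
    exact hwE (Finset.mem_union_left _ hx)
  have hYw : ∀ y ∈ Y, y ≠ w := by
    rintro y hy rfl; exact hjk (hwj.symm.trans (hY y hy))
  have hwt : G.colour w t = β := by
    rw [hwc t (Finset.mem_insert_self _ _), if_pos rfl]
  have hwS : ∀ s ∈ S, G.colour w s = α := by
    intro s hs
    rw [hwc s (Finset.mem_insert_of_mem (by simpa using hs)), if_neg]
    rintro rfl; exact htS hs
  have hσwj : G.part (σ w) = j := by rw [σp, hwj]
  have hYσw : ∀ y ∈ Y, y ≠ σ w := by
    rintro y hy h; exact hjk (hσwj.symm.trans (by rw [← h, hY y hy]))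
  have hXσw : ∀ x ∈ X, σ x ≠ σ w := fun x hx h => hwX' x hx (σ.injective h)
  -- second automorphism: fixes `σ X` and `Y`, sends `σ w` to `w`
  have hZ : ∀ z ∈ ((X.image σ ∪ Y : Finset G.V) : Set G.V), z ≠ σ w ∧ z ≠ w ∧
      (G.part z ≠ j → G.colour w z = G.colour (σ w) z) := by
    intro z hz
    rcases Finset.mem_union.mp (Finset.mem_coe.mp hz) with hz | hz
    · obtain ⟨x, hx, rfl⟩ := Finset.mem_image.mp hz
      exact ⟨hXσw x hx, hwX x hx, fun h => absurd (by rw [σp, hX x hx]) h⟩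
    · refine ⟨hYσw z hz, hYw z hz, fun _ => ?_⟩
      have := σc w z (by rw [hwj, hY z hz]; exact hjk)
      rw [σY z hz] at this
      exact this.symm
  obtain ⟨τ, τp, τc, τe⟩ := hH (insert (σ w) ((X.image σ ∪ Y : Finset G.V) : Set G.V))
    ((Finset.finite_toSet _).insert _) (Function.update id (σ w) w) (by
      refine ⟨?_, ?_, ?_⟩
      · rintro x (rfl | hx) y (rfl | hy) hxy
        · rfl
        · rw [Function.update_self, Function.update_of_ne (hZ y hy).1] at hxy
          exact absurd hxy.symm (hZ y hy).2.1
        · rw [Function.update_self, Function.update_of_ne (hZ x hx).1] at hxy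
          exact absurd hxy (hZ x hx).2.1
        · rwa [Function.update_of_ne (hZ x hx).1, Function.update_of_ne (hZ y hy).1] at hxy
      · rintro x (rfl | hx)
        · rw [Function.update_self, σp]
        · rw [Function.update_of_ne (hZ x hx).1]; rfl
      · rintro x (rfl | hx) y (rfl | hy) hxy
        · exact absurd rfl hxy
        · rw [Function.update_self, Function.update_of_ne (hZ y hy).1]
          exact (hZ y hy).2.2 (by rw [hσwj] at hxy; exact hxy.symm)
        · rw [Function.update_self, Function.update_of_ne (hZ x hx).1, G.colour_symm,
            G.colour_symm x]
          exact (hZ x hx).2.2 (by rw [hσwj] at hxy; exact hxy)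
        · rw [Function.update_of_ne (hZ x hx).1, Function.update_of_ne (hZ y hy).1]; rfl)
  have τw : τ (σ w) = w := by rw [τe _ (Or.inl rfl), Function.update_self]
  have τZ : ∀ z ∈ ((X.image σ ∪ Y : Finset G.V) : Set G.V), τ z = z := by
    intro z hz
    rw [τe z (Or.inr hz), Function.update_of_ne (hZ z hz).1]; rfl
  have τX : ∀ x ∈ X, τ (σ x) = σ x := fun x hx =>
    τZ _ (Finset.mem_coe.mpr (Finset.mem_union_left _ (Finset.mem_image_of_mem _ hx)))
  have τY : ∀ y ∈ Y, τ (σ y) = y := fun y hy => by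
    rw [σY y hy]; exact τZ _ (Finset.mem_coe.mpr (Finset.mem_union_right _ hy))
  obtain ⟨s0', hs0'⟩ := τ.surjective t
  obtain ⟨s0, rfl⟩ := σ.surjective s0'
  have hs0i : G.part s0 = i := by rw [← σp, ← τp, hs0', hti]
  have hρ : ∀ v, G.part v ≠ i → G.colour s0 v = G.colour t (τ (σ v)) := by
    intro v hv
    rw [← hs0', τc _ _ (by rw [σp, σp, hs0i]; exact hv.symm), σc _ _ (by rw [hs0i]; exact hv.symm)]
  have hs0S : s0 ∈ S := by
    refine ⟨hs0i, fun x hx => ?_, fun y hy => ?_⟩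
    · have hne : G.part x ≠ i := by rw [hX x hx]; exact hij.symm
      rw [hρ x hne, τX x hx, ← σa, σc _ _ (by rw [ha]; exact hne.symm)]
    · have hne : G.part y ≠ i := by rw [hY y hy]; exact hik.symm
      rw [hρ y hne, τY y hy, htY y hy]
  have h1 := hwS s0 hs0S
  have h2 := hρ w (by rw [hwj]; exact hij.symm)
  rw [τw, G.colour_symm, h1, G.colour_symm, hwt] at h2
  exact hαβ h2

/-- Realizations of restrictions as partial functions. -/
theorem realized_restrict {L : MLang 3} {G A : LGraph L} [Nonempty G.V] {S : Set A.V}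
    (h : G.Realized (A.restrict S)) : ∃ f : A.V → G.V, Set.InjOn f S ∧
      (∀ x ∈ S, G.part (f x) = A.part x) ∧
      ∀ x ∈ S, ∀ y ∈ S, A.part x ≠ A.part y → G.colour (f x) (f y) = A.colour x y := by
  classical
  obtain ⟨f, h1, h2, h3⟩ := h
  have key : ∀ x (hx : x ∈ S), (if h : x ∈ S then f ⟨x, h⟩ else Classical.arbitrary G.V)
      = f ⟨x, hx⟩ := fun x hx => dif_pos hx
  refine ⟨fun x => if h : x ∈ S then f ⟨x, h⟩ else Classical.arbitrary G.V, ?_, ?_, ?_⟩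
  · intro x hx y hy hxy
    simp only [key x hx, key y hy] at hxy
    exact congrArg Subtype.val (h1 hxy)
  · intro x hx
    simp only [key x hx]
    exact h2 ⟨x, hx⟩
  · intro x hx y hy hxy
    simp only [key x hx, key y hy]
    exact h3 ⟨x, hx⟩ ⟨y, hy⟩ hxy

theorem realized_of_update {L : MLang 3} {G A : LGraph L} (y : A.V) (f : A.V → G.V) (s : G.V)
    (h1 : Set.InjOn f {v | v ≠ y}) (h2 : ∀ x ≠ y, G.part (f x) = A.part x)
    (h3 : ∀ x ≠ y, ∀ z ≠ y, A.part x ≠ A.part z → G.colour (f x) (f z) = A.colour x z)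
    (hs1 : ∀ x ≠ y, f x ≠ s) (hs2 : G.part s = A.part y)
    (hs3 : ∀ x ≠ y, A.part y ≠ A.part x → G.colour s (f x) = A.colour y x) :
    G.Realized A := by
  classical
  refine ⟨Function.update f y s, ?_, ?_, ?_⟩
  · intro a b hab
    by_cases ha : a = y <;> by_cases hb : b = y
    · rw [ha, hb]
    · rw [ha, Function.update_self, Function.update_of_ne hb] at hab
      exact absurd hab.symm (hs1 b hb)
    · rw [hb, Function.update_self, Function.update_of_ne ha] at hab
      exact absurd hab (hs1 a ha)
    · rw [Function.update_of_ne ha, Function.update_of_ne hb] at hab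
      exact h1 ha hb hab
  · intro a
    by_cases ha : a = y
    · rw [ha, Function.update_self, hs2]
    · rw [Function.update_of_ne ha, h2 a ha]
  · intro a b hab
    by_cases ha : a = y <;> by_cases hb : b = y
    · exact absurd (by rw [ha, hb]) hab
    · subst ha
      rw [Function.update_self, Function.update_of_ne hb]
      exact hs3 b hb hab
    · subst hb
      rw [Function.update_self, Function.update_of_ne ha, G.colour_symm, A.colour_symm]
      exact hs3 a ha hab.symm
    · rw [Function.update_of_ne ha, Function.update_of_ne hb]
      exact h3 a ha b hb hab

theorem minOmitted_monic {L : MLang 3} {G : LGraph L} (hH : G.Homogeneous) (hG : G.Generic)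
    {A : LGraph L} (hA : G.MinOmitted A) : A.Monic := by
  classical
  obtain ⟨hfin, homit, hmin⟩ := hA
  intro x y hpart
  by_contra hxy
  cases nonempty_fintype A.V
  have hne : Nonempty G.V := ⟨(hG.2.1 0).nonempty.some⟩
  obtain ⟨f, f1, f2, f3⟩ := realized_restrict (hmin {v | v ≠ y} (fun h => by
    have : y ∈ {v | v ≠ y} := h ▸ Set.mem_univ y
    exact this rfl))
  apply homit
  by_cases hsame : ∀ v, A.part v ≠ A.part x → A.colour x v = A.colour y v
  · obtain ⟨j, k, hij, hik, hjk⟩ : ∃ j k : Fin 3, A.part x ≠ j ∧ A.part x ≠ k ∧ j ≠ k := by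
      generalize A.part x = i
      revert i; decide
    have hinf := not_algebraic hH hG hij hik hjk
      ((Finset.univ.filter (fun v => A.part v = j)).image f)
      ((Finset.univ.filter (fun v => A.part v = k)).image f)
      (by
        intro z hz
        obtain ⟨v, hv, rfl⟩ := Finset.mem_image.mp hz
        have hv : A.part v = j := by simpa using hv
        rw [f2 v (by rintro rfl; exact hij (hpart.trans hv)), hv])
      (by
        intro z hz
        obtain ⟨v, hv, rfl⟩ := Finset.mem_image.mp hz
        have hv : A.part v = k := by simpa using hv
        rw [f2 v (by rintro rfl; exact hik (hpart.trans hv)), hv])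
      (f x) (f2 x hxy)
    obtain ⟨s, ⟨hs1, hs2, hs3⟩, hs4⟩ := hinf.exists_notMem_finset (Finset.univ.image f)
    refine realized_of_update y f s f1 f2 f3 ?_ (hs1.trans hpart) ?_
    · rintro v - rfl
      exact hs4 (Finset.mem_image_of_mem _ (Finset.mem_univ v))
    · intro v hv hyv
      rw [← hpart] at hyv
      rw [← hsame v hyv.symm, ← f3 x hxy v hv hyv]
      rcases fin3_cover hij hik hjk (A.part v) with e | e | e
      · exact absurd e.symm hyv
      · exact hs2 _ (Finset.mem_image_of_mem _ (by simpa using e))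
      · exact hs3 _ (Finset.mem_image_of_mem _ (by simpa using e))
  · push Not at hsame
    obtain ⟨v, hv, hvc⟩ := hsame
    obtain ⟨g, g1, g2, g3⟩ := realized_restrict (hmin {v | v ≠ x} (fun h => by
      have : x ∈ {v | v ≠ x} := h ▸ Set.mem_univ x
      exact this rfl))
    -- an automorphism moving `g` to `f` away from `x, y`
    let W : Set A.V := {v | v ≠ x ∧ v ≠ y}
    have hgW : Set.InjOn g W := fun a ha b hb h => g1 ha.1 hb.1 h
    have hnA : Nonempty A.V := ⟨x⟩
    have hinv : ∀ a ∈ W, Function.invFunOn g W (g a) = a := fun a ha =>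
      hgW.leftInvOn_invFunOn ha
    obtain ⟨σ, σp, σc, σe⟩ := hH (g '' W) (Set.toFinite _)
      (fun z => f (Function.invFunOn g W z)) (by
        refine ⟨?_, ?_, ?_⟩
        · rintro _ ⟨a, ha, rfl⟩ _ ⟨b, hb, rfl⟩ h
          simp only [hinv a ha, hinv b hb] at h
          rw [f1 ha.2 hb.2 h]
        · rintro _ ⟨a, ha, rfl⟩
          simp only [hinv a ha]
          rw [f2 a ha.2, g2 a ha.1]
        · rintro _ ⟨a, ha, rfl⟩ _ ⟨b, hb, rfl⟩ h
          simp only [hinv a ha, hinv b hb]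
          rw [g2 a ha.1, g2 b hb.1] at h
          rw [f3 a ha.2 b hb.2 h, g3 a ha.1 b hb.1 h])
    have hσ : ∀ a ∈ W, σ (g a) = f a := by
      intro a ha
      rw [σe _ ⟨a, ha, rfl⟩]
      simp only [hinv a ha]
    have hyx : y ≠ x := fun h => hxy h.symm
    have hcol : ∀ a, a ≠ y → A.part y ≠ A.part a →
        G.colour (σ (g y)) (f a) = A.colour y a := by
      intro a ha hya
      have hax : a ≠ x := by rintro rfl; exact hya hpart.symm
      rw [← hσ a ⟨hax, ha⟩, σc _ _ (by rw [g2 y hyx, g2 a hax]; exact hya), g3 y hyx a hax hya]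
    refine realized_of_update y f (σ (g y)) f1 f2 f3 ?_ (by rw [σp, g2 y hyx]) hcol
    intro a ha h
    by_cases hax : a = x
    · subst hax
      have hvy : v ≠ y := by rintro rfl; exact hv hpart.symm
      apply hvc
      rw [← hcol v hvy (by rw [← hpart]; exact hv.symm), ← h, f3 a hxy v hvy hv.symm]
    · rw [← hσ a ⟨hax, ha⟩] at h
      exact ha (g1 hax hyx (σ.injective h))

theorem monic_missing_realized {L : MLang 3} {G : LGraph L} (hG : G.Generic) {A : LGraph L}
    (hm : A.Monic) (l : Fin 3) (hl : ∀ x : A.V, A.part x ≠ l) : G.Realized A := by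
  classical
  obtain ⟨j, k, hij, hik, hjk⟩ : ∃ j k : Fin 3, l ≠ j ∧ l ≠ k ∧ j ≠ k := by
    clear hl; revert l; decide
  obtain ⟨c, hc, hcA⟩ : ∃ c ∈ L.C j k, ∀ x y : A.V, A.part x = k → A.part y = j →
      A.colour x y = c := by
    by_cases h : ∃ x y : A.V, A.part x = k ∧ A.part y = j
    · obtain ⟨x, y, hx, hy⟩ := h
      refine ⟨A.colour x y, ?_, ?_⟩
      · have := A.colour_mem x y (by rw [hx, hy]; exact hjk.symm)
        rw [hx, hy] at this
        rwa [L.symm]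
      · intro x' y' hx' hy'
        rw [hm x' x (hx'.trans hx.symm), hm y' y (hy'.trans hy.symm)]
    · obtain ⟨c, hc⟩ := L.nonempty j k hjk
      exact ⟨c, hc, fun x y hx hy => absurd ⟨x, y, hx, hy⟩ h⟩
  obtain ⟨u, hu⟩ := (hG.2.1 j).nonempty
  have hu : G.part u = j := hu
  obtain ⟨x, hx, hxc⟩ := hG.2.2 j k hjk {u} (by simpa using hu) (fun _ => c) (by simpa using hc)
  have hxc : G.colour x u = c := hxc u (by simp)
  have hcov : ∀ v : A.V, A.part v = j ∨ A.part v = k := by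
    intro v
    rcases fin3_cover hij hik hjk (A.part v) with e | e | e
    · exact absurd e (hl v)
    · exact Or.inl e
    · exact Or.inr e
  have fp : ∀ v, G.part (if A.part v = j then u else x) = A.part v := by
    intro v
    rcases hcov v with e | e
    · rw [if_pos e, hu, e]
    · rw [if_neg (by rw [e]; exact hjk.symm), hx, e]
  refine ⟨fun v => if A.part v = j then u else x, ?_, fp, ?_⟩
  · intro v w hvw
    apply hm
    rw [← fp v, ← fp w]
    exact congrArg G.part hvw
  · intro v w hvw
    simp only
    rcases hcov v with e | e <;> rcases hcov w with e' | e'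
    · exact absurd (e.trans e'.symm) hvw
    · rw [if_pos e, if_neg (by rw [e']; exact hjk.symm), A.colour_symm, G.colour_symm, hxc,
        hcA w v e' e]
    · rw [if_pos e', if_neg (by rw [e]; exact hjk.symm), hxc, hcA v w e e']
    · exact absurd (e.trans e'.symm) hvw

theorem minOmitted_triangle {L : MLang 3} {G : LGraph L} (hH : G.Homogeneous) (hG : G.Generic)
    {A : LGraph L} (hA : G.MinOmitted A) : A.IsTriangle := by
  have hm := minOmitted_monic hH hG hA
  refine isTriangle_of hm fun l => ?_
  by_contra h
  push Not at h
  exact hA.2.1 (monic_missing_realized hG hm l h)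

theorem part_one_cover {L : MLang 3} {G : LGraph L} (hH : G.Homogeneous) (hG : G.Generic)
    (i j : Fin 3) (hij : i ≠ j) :
    ∃ c ∈ L.C i j, ∀ A : LGraph L, G.MinOmitted A → ¬ A.Covers i j c := by
  classical
  by_contra hcon
  push Not at hcon
  obtain ⟨k, hik, hjk⟩ : ∃ k : Fin 3, i ≠ k ∧ j ≠ k := by
    clear hcon; revert i j; decide
  let F : Set (LGraph L) := {A | G.MinOmitted A}
  have hF : ∀ A ∈ F, A.IsTriangle := fun A hA => minOmitted_triangle hH hG hA
  have hO : Omits F G := (omits_iff hF G).mpr fun A hA => hA.2.1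
  have hex : ∀ c, ∃ a b, c ∈ L.C i j → Bad F i j k c a b ∧ a ∈ L.C k i ∧ b ∈ L.C k j := by
    intro c
    by_cases hc : c ∈ L.C i j
    · obtain ⟨A, hA, x, y, hx, hy, hxy⟩ := hcon c hc
      obtain ⟨z, hz⟩ := (hF A hA).all_parts k
      refine ⟨A.colour x z, A.colour y z, fun _ =>
        ⟨⟨A, hA, x, y, z, hx, hy, hz, hxy, rfl, rfl⟩, ?_, ?_⟩⟩
      · have := A.colour_mem x z (by rw [hx, hz]; exact hik)
        rwa [hx, hz, L.symm] at this
      · have := A.colour_mem y z (by rw [hy, hz]; exact hjk)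
        rwa [hy, hz, L.symm] at this
    · exact ⟨0, 0, fun h => absurd h hc⟩
  choose a b hab using hex
  -- distinct vertices `z c` in part `k`
  let z : ℕ → G.V := fun n => ((hG.2.1 k).natEmbedding _ n).1
  have hz : Function.Injective z := fun m n h =>
    ((hG.2.1 k).natEmbedding _).injective (Subtype.ext h)
  have hzk : ∀ n, G.part (z n) = k := fun n => ((hG.2.1 k).natEmbedding _ n).2
  have hzi : ∀ n, Function.invFun z (z n) = n := Function.leftInverse_invFun hz
  have hUk : ∀ u ∈ (L.C i j).image z, G.part u = k := by
    intro u hu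
    obtain ⟨n, -, rfl⟩ := Finset.mem_image.mp hu
    exact hzk n
  obtain ⟨x, hx, hxc⟩ := hG.2.2 k i hik.symm ((L.C i j).image z) hUk
    (fun u => a (Function.invFun z u)) (by
      intro u hu
      obtain ⟨n, hn, rfl⟩ := Finset.mem_image.mp hu
      simp only [hzi]
      exact (hab n hn).2.1)
  obtain ⟨y, hy, hyc⟩ := hG.2.2 k j hjk.symm ((L.C i j).image z) hUk
    (fun u => b (Function.invFun z u)) (by
      intro u hu
      obtain ⟨n, hn, rfl⟩ := Finset.mem_image.mp hu
      simp only [hzi]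
      exact (hab n hn).2.2)
  have hc : G.colour x y ∈ L.C i j := by
    have := G.colour_mem x y (by rw [hx, hy]; exact hij)
    rwa [hx, hy] at this
  have hzm := Finset.mem_image_of_mem z hc
  have := hO x y (z (G.colour x y))
  rw [hx, hy, hzk, hxc _ hzm, hyc _ hzm] at this
  simp only [hzi] at this
  exact this hij hik hjk (hab _ hc).1

/-- Classification of homogeneous 3-generic graphs.
(1) If `G` is homogeneous 3-generic, then `O(G)` is a class of triangles which for each
pair of distinct parts leaves some colour uncovered.
(2) Conversely, for every class `ℱ` of pairwise non-isomorphic triangles leaving, for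
each pair of distinct parts, some colour uncovered, `Forb ℱ` is an amalgamation class
and there is a countable homogeneous 3-generic `G` with `O(G) = ℱ`. -/
theorem classification_3generic (L : MLang 3) :
    (∀ G : LGraph L, G.Homogeneous → G.Generic →
      (∀ A : LGraph L, G.MinOmitted A → A.IsTriangle) ∧
      (∀ i j : Fin 3, i ≠ j →
        ∃ c ∈ L.C i j, ∀ A : LGraph L, G.MinOmitted A → ¬ A.Covers i j c)) ∧
    (∀ F : Set (LGraph L),
      (∀ A ∈ F, A.IsTriangle) →
      (∀ A ∈ F, ∀ B ∈ F, A ≠ B → ¬ A.IsIsomorphic B) →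
      (∀ i j : Fin 3, i ≠ j → ∃ c ∈ L.C i j, ∀ A ∈ F, ¬ A.Covers i j c) →
      IsAmalgamationClass (Forb F) ∧
      ∃ G : LGraph L, Countable G.V ∧ G.Homogeneous ∧ G.Generic ∧
        ∀ A : LGraph L, G.MinOmitted A ↔ ∃ B ∈ F, B.IsIsomorphic A) := by
  exact ⟨fun G hH hG => ⟨fun A hA => minOmitted_triangle hH hG hA,
      fun i j hij => part_one_cover hH hG i j hij⟩,
    fun F hF _ hunc => part_two F hF hunc⟩
end
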